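/- arXiv:1305.1104 — 5 statements merged into one kernel-verified Lean document; each statement's English description precedes it below -/
import Mathlib

section
/- Fix x ∈ X. For Lebesgue-almost every θ ∈ [0, 2π] the following holds: whenever T_k → ∞ is a sequence of positive reals and ν_θ is a finite Borel measure on X such that the measures φ ↦ (1/T_k) ∫₀^{T_k} φ(g_t r_θ · x) dt converge to ν_θ in the weak-* sense, then ν_θ is invariant under every upper triangular matrix in SL(2,ℝ) with positive diagonal entries, i.e. ∫_X φ(p·y) dν_θ(y) = ∫_X φ(y) dν_θ(y) for every such matrix p and every compactly supported continuous φ: X → ℝ. -/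
open MeasureTheory Filter Topology Matrix Real

/-- `SL(2,ℝ)`: the group of 2×2 real matrices of determinant 1. -/
abbrev SL2 : Type := Matrix.SpecialLinearGroup (Fin 2) ℝ

/-- The topology on `SL(2,ℝ)` induced from the space of 2×2 real matrices. -/
noncomputable instance : TopologicalSpace SL2 :=
  TopologicalSpace.induced (fun g : SL2 => (g : Matrix (Fin 2) (Fin 2) ℝ)) inferInstance

/-- The diagonal matrix `g_t = [[eᵗ, 0], [0, e⁻ᵗ]]` as an element of `SL(2,ℝ)`. -/
noncomputable def gMat (t : ℝ) : SL2 :=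
  ⟨!![Real.exp t, 0; 0, Real.exp (-t)], by
    simp [Matrix.det_fin_two_of, ← Real.exp_add]⟩

/-- The rotation matrix `r_θ = [[cos θ, sin θ], [−sin θ, cos θ]]` as an element of `SL(2,ℝ)`. -/
noncomputable def rMat (θ : ℝ) : SL2 :=
  ⟨!![Real.cos θ, Real.sin θ; -Real.sin θ, Real.cos θ], by
    simp [Matrix.det_fin_two_of]; nlinarith [Real.sin_sq_add_cos_sq θ]⟩

/-- The operator norm of a 2×2 real matrix (as an operator on Euclidean ℝ²). -/
noncomputable def opNorm2 (m : Matrix (Fin 2) (Fin 2) ℝ) : ℝ :=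
  ‖Matrix.toEuclideanCLM (𝕜 := ℝ) m‖

/-- The entrywise `ℓ¹` norm of a 2×2 real matrix. -/
noncomputable def entryNorm (m : Matrix (Fin 2) (Fin 2) ℝ) : ℝ :=
  |m 0 0| + |m 0 1| + |m 1 0| + |m 1 1|

theorem exists_opNorm2_le_mul_entryNorm :
    ∃ C > (0 : ℝ), ∀ m : Matrix (Fin 2) (Fin 2) ℝ, opNorm2 m ≤ C * entryNorm m := by
  let E : Fin 2 → Fin 2 → ℝ := fun i j => opNorm2 (Matrix.single i j 1)
  have hE : ∀ i j, 0 ≤ E i j := fun i j => norm_nonneg _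
  refine ⟨E 0 0 + E 0 1 + E 1 0 + E 1 1 + 1, by
    linarith [hE 0 0, hE 0 1, hE 1 0, hE 1 1], fun m => ?_⟩
  have hsum : m = m 0 0 • Matrix.single 0 0 (1 : ℝ) + m 0 1 • Matrix.single 0 1 (1 : ℝ)
      + m 1 0 • Matrix.single 1 0 (1 : ℝ) + m 1 1 • Matrix.single 1 1 (1 : ℝ) := by
    ext i j
    fin_cases i <;> fin_cases j <;> simp [Matrix.single]
  have hle : opNorm2 m ≤ |m 0 0| * E 0 0 + |m 0 1| * E 0 1 + |m 1 0| * E 1 0 + |m 1 1| * E 1 1 := by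
    conv_lhs => rw [hsum]
    simp only [opNorm2, map_add, map_smul]
    refine (norm_add_le _ _).trans (add_le_add ((norm_add_le _ _).trans
      (add_le_add ((norm_add_le _ _).trans (add_le_add ?_ ?_)) ?_)) ?_) <;>
    exact (norm_smul _ _).le
  refine hle.trans ?_
  unfold entryNorm
  have := hE 0 0
  have := hE 0 1
  have := hE 1 0
  have := hE 1 1
  nlinarith [abs_nonneg (m 0 0), abs_nonneg (m 0 1), abs_nonneg (m 1 0), abs_nonneg (m 1 1)]

theorem entryNorm_nonneg (m : Matrix (Fin 2) (Fin 2) ℝ) : 0 ≤ entryNorm m := by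
  unfold entryNorm; positivity

theorem entryNorm_inv_sub_one (h : SL2) :
    entryNorm (((h⁻¹ : SL2) : Matrix (Fin 2) (Fin 2) ℝ) - 1)
      = entryNorm ((h : Matrix (Fin 2) (Fin 2) ℝ) - 1) := by
  simp [entryNorm, Matrix.adjugate_fin_two]
  ring

theorem exists_entryNorm_lt_imp_mem {U : Set SL2} (hU : U ∈ 𝓝 (1 : SL2)) :
    ∃ δ > (0 : ℝ), ∀ h : SL2, entryNorm ((h : Matrix (Fin 2) (Fin 2) ℝ) - 1) < δ → h ∈ U := by
  obtain ⟨V, hV, hVU⟩ := mem_nhds_induced _ _ _ |>.1 hU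
  obtain ⟨δ, hδ, hball⟩ := Metric.mem_nhds_iff (α := Fin 2 → Fin 2 → ℝ).1 hV
  refine ⟨δ, hδ, fun h hh => hVU (hball ?_)⟩
  refine (dist_pi_lt_iff hδ).2 fun i => (dist_pi_lt_iff hδ).2 fun j => ?_
  change |(h : Matrix (Fin 2) (Fin 2) ℝ) i j - (1 : Matrix (Fin 2) (Fin 2) ℝ) i j| < δ
  refine lt_of_le_of_lt ?_ hh
  simp only [entryNorm, Matrix.sub_apply]
  fin_cases i <;> fin_cases j <;> simp <;>
    linarith [abs_nonneg ((h : Matrix (Fin 2) (Fin 2) ℝ) 0 0 - 1),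
      abs_nonneg ((h : Matrix (Fin 2) (Fin 2) ℝ) 1 1 - 1),
      abs_nonneg ((h : Matrix (Fin 2) (Fin 2) ℝ) 0 1),
      abs_nonneg ((h : Matrix (Fin 2) (Fin 2) ℝ) 1 0)]

theorem exists_abs_smul_sub_le {X : Type*} [MetricSpace X] [MulAction SL2 X]
    (hlip : ∀ K : Set X, IsCompact K →
      ∃ C > (0:ℝ), ∃ U ∈ 𝓝 (1 : SL2), ∀ y ∈ K, ∀ h ∈ U,
        dist (h • y) y ≤ C * opNorm2 ((h : Matrix (Fin 2) (Fin 2) ℝ) - 1))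
    {φ : X → ℝ} {κ : NNReal} (hφ : LipschitzWith κ φ) (hc : HasCompactSupport φ)
    {B : ℝ} (hB : ∀ y, |φ y| ≤ B) :
    ∃ L, 0 ≤ L ∧ ∀ (h : SL2) (y : X),
      |φ (h • y) - φ y| ≤ L * entryNorm ((h : Matrix (Fin 2) (Fin 2) ℝ) - 1) := by
  obtain ⟨C, hC, U, hU, hCU⟩ := hlip _ hc
  obtain ⟨δ, hδ, hδU⟩ := exists_entryNorm_lt_imp_mem hU
  obtain ⟨A, hA, hop⟩ := exists_opNorm2_le_mul_entryNorm
  have key : ∀ (h : SL2) (y : X), h ∈ U → y ∈ tsupport φ →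
      |φ (h • y) - φ y| ≤ κ * C * A * entryNorm ((h : Matrix (Fin 2) (Fin 2) ℝ) - 1) := by
    intro h y hh hy
    rw [← Real.dist_eq]
    calc dist (φ (h • y)) (φ y) ≤ κ * dist (h • y) y := hφ.dist_le_mul _ _
      _ ≤ κ * (C * (A * entryNorm ((h : Matrix (Fin 2) (Fin 2) ℝ) - 1))) := by
        gcongr
        exact (hCU y hy h hh).trans (by gcongr; exact hop _)
      _ = _ := by ring
  refine ⟨κ * C * A + 2 * |B| / δ, by positivity, fun h y => ?_⟩
  set N := entryNorm ((h : Matrix (Fin 2) (Fin 2) ℝ) - 1) with hN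
  have hN0 : 0 ≤ N := entryNorm_nonneg _
  have hκ : 0 ≤ κ * C * A := by positivity
  rcases lt_or_ge N δ with hlt | hge
  · have hsmall : |φ (h • y) - φ y| ≤ κ * C * A * N := by
      by_cases hy : y ∈ tsupport φ
      · exact key h y (hδU h hlt) hy
      by_cases hy' : h • y ∈ tsupport φ
      · have := key h⁻¹ (h • y) (hδU _ (by rwa [entryNorm_inv_sub_one])) hy'
        rwa [inv_smul_smul, entryNorm_inv_sub_one, abs_sub_comm] at this
      · rw [image_eq_zero_of_notMem_tsupport hy, image_eq_zero_of_notMem_tsupport hy']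
        simpa using by positivity
    have : 0 ≤ 2 * |B| / δ * N := by positivity
    linarith
  · have h1 : |φ (h • y) - φ y| ≤ 2 * |B| := by
      have := abs_sub (φ (h • y)) (φ y)
      linarith [hB (h • y), hB y, le_abs_self B]
    have h2 : 2 * |B| ≤ 2 * |B| / δ * N := by
      rw [div_mul_eq_mul_div, le_div_iff₀ hδ]
      gcongr
    have : 0 ≤ κ * C * A * N := by positivity
    linarith

/-- The unipotent matrix `u_s = [[1, s], [0, 1]]`. -/
noncomputable def uMat (s : ℝ) : SL2 :=
  ⟨!![1, s; 0, 1], by simp [Matrix.det_fin_two_of]⟩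

theorem coe_uMat (s : ℝ) : (uMat s : Matrix (Fin 2) (Fin 2) ℝ) = !![1, s; 0, 1] := rfl

theorem coe_gMat (t : ℝ) :
    (gMat t : Matrix (Fin 2) (Fin 2) ℝ) = !![Real.exp t, 0; 0, Real.exp (-t)] := rfl

theorem coe_rMat (θ : ℝ) :
    (rMat θ : Matrix (Fin 2) (Fin 2) ℝ)
      = !![Real.cos θ, Real.sin θ; -Real.sin θ, Real.cos θ] := rfl

theorem continuous_gMat_mul_rMat : Continuous fun p : ℝ × ℝ => gMat p.1 * rMat p.2 := by
  refine continuous_induced_rng.2 (continuous_matrix fun i j => ?_)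
  fin_cases i <;> fin_cases j <;> simp [coe_rMat, coe_gMat] <;> fun_prop

theorem gMat_add (s t : ℝ) : gMat (s + t) = gMat s * gMat t := by
  ext i j
  fin_cases i <;> fin_cases j <;> simp [coe_gMat, Real.exp_add, mul_comm]

theorem rMat_add (s t : ℝ) : rMat (s + t) = rMat s * rMat t := by
  ext i j
  fin_cases i <;> fin_cases j <;> simp [coe_rMat, Real.cos_add, Real.sin_add] <;> ring

theorem gMat_zero : gMat 0 = 1 := by
  ext i j
  fin_cases i <;> fin_cases j <;> simp [coe_gMat]

theorem rMat_add_two_pi (θ : ℝ) : rMat (θ + 2 * π) = rMat θ := by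
  ext i j
  fin_cases i <;> fin_cases j <;> simp [coe_rMat]

theorem abs_cos_sub_one_le_abs (δ : ℝ) : |Real.cos δ - 1| ≤ |δ| := by
  have := Real.abs_cos_sub_cos_le δ 0
  simpa using this

theorem entryNorm_gMat_conj_rMat_sub_one_le {t : ℝ} (ht : 0 ≤ t) (δ : ℝ) :
    entryNorm (((gMat t * rMat δ * gMat (-t) : SL2) : Matrix (Fin 2) (Fin 2) ℝ) - 1)
      ≤ 4 * Real.exp (2 * t) * |δ| := by
  have hs : |Real.sin δ| ≤ |δ| := Real.abs_sin_le_abs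
  have hcos : |Real.cos δ - 1| ≤ |δ| := abs_cos_sub_one_le_abs δ
  have e1 : Real.exp t * Real.exp (-t) = 1 := by rw [← Real.exp_add]; simp
  have e2 : Real.exp t * Real.exp t = Real.exp (2 * t) := by rw [← Real.exp_add]; ring_nf
  have h1 : 1 ≤ Real.exp (2 * t) := Real.one_le_exp (by positivity)
  have h3 : Real.exp (-t) ≤ 1 := Real.exp_le_one_iff.2 (by linarith)
  have a00 : Real.exp t * Real.cos δ * Real.exp (-t) = Real.cos δ := by
    linear_combination Real.cos δ * e1
  have a11 : Real.exp (-t) * Real.cos δ * Real.exp t = Real.cos δ := by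
    linear_combination Real.cos δ * e1
  have a01 : Real.exp t * Real.sin δ * Real.exp t = Real.exp (2 * t) * Real.sin δ := by
    linear_combination Real.sin δ * e2
  have h4 : Real.exp (-t) * |Real.sin δ| * Real.exp (-t) ≤ |δ| := by
    have := abs_nonneg (Real.sin δ)
    have h5 : Real.exp (-t) * Real.exp (-t) ≤ 1 := by
      nlinarith [Real.exp_pos (-t)]
    nlinarith
  simp [entryNorm, coe_gMat, coe_rMat, a00, a11, a01, abs_mul]
  nlinarith [abs_nonneg δ, Real.exp_pos (2 * t)]

theorem arctan_le_self_of_nonneg {x : ℝ} (hx : 0 ≤ x) : Real.arctan x ≤ x := by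
  simpa [Real.tan_arctan] using
    Real.le_tan (Real.arctan_nonneg.2 hx) (Real.arctan_lt_pi_div_two x)

theorem entryNorm_uMat_mul_gMat_conj_rMat_sub_one_le {t : ℝ} (ht : 0 ≤ t) :
    entryNorm (((uMat 1 * (gMat t * rMat (-Real.arctan (Real.exp (-(2 * t)))) * gMat (-t)) : SL2)
      : Matrix (Fin 2) (Fin 2) ℝ) - 1) ≤ 3 * Real.exp (-(2 * t)) := by
  set ε := Real.exp (-(2 * t)) with hε
  have hε0 : 0 < ε := Real.exp_pos _
  set q := √(1 + ε ^ 2) with hq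
  have hq0 : 0 < q := Real.sqrt_pos.2 (by positivity)
  have hqq : q * q = 1 + ε ^ 2 := Real.mul_self_sqrt (by positivity)
  have hq1 : 1 ≤ q := by nlinarith
  have hqε : q ≤ 1 + ε := by nlinarith
  have e1 : Real.exp t * Real.exp (-t) = 1 := by rw [← Real.exp_add]; simp
  have e2 : Real.exp (-t) * Real.exp (-t) = ε := by rw [← Real.exp_add, hε]; ring_nf
  have e3 : Real.exp t * Real.exp t * ε = 1 := by
    linear_combination -(Real.exp t * Real.exp t) * e2 +
      (Real.exp t * Real.exp (-t) + 1) * e1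
  have hε1 : ε ≤ 1 := Real.exp_le_one_iff.2 (by linarith)
  have hqinv : 1 / q ≤ 1 := by rw [div_le_one hq0]; exact hq1
  have hqinv' : 1 - ε ≤ 1 / q := by
    rw [le_div_iff₀ hq0]; nlinarith
  set M := (((uMat 1 * (gMat t * rMat (-Real.arctan ε) * gMat (-t)) : SL2)
      : Matrix (Fin 2) (Fin 2) ℝ)) with hM
  have h00 : M 0 0 = q := by
    simp [hM, coe_uMat, coe_gMat, coe_rMat, Real.cos_arctan, Real.sin_arctan, ← hq]
    field_simp
    linear_combination e1 + ε * e2 - hqq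
  have h01 : M 0 1 = 0 := by
    simp [hM, coe_uMat, coe_gMat, coe_rMat, Real.cos_arctan, Real.sin_arctan, ← hq]
    field_simp
    linear_combination e1 - e3
  have h10 : M 1 0 = ε * ε / q := by
    simp [hM, coe_uMat, coe_gMat, coe_rMat, Real.cos_arctan, Real.sin_arctan, ← hq]
    field_simp
    linear_combination e2
  have h11 : M 1 1 = 1 / q := by
    simp [hM, coe_uMat, coe_gMat, coe_rMat, Real.cos_arctan, Real.sin_arctan, ← hq]
    field_simp
    linear_combination e1
  have hlow : ε * ε / q ≤ ε := by
    rw [div_le_iff₀ hq0]; nlinarith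
  have b0 : |q - 1| ≤ ε := abs_le.2 ⟨by linarith, by linarith⟩
  have b1 : |1 / q - 1| ≤ ε := abs_le.2 ⟨by linarith, by linarith⟩
  have b2 : |ε * ε / q| ≤ ε := by rwa [abs_of_nonneg (by positivity)]
  simp only [entryNorm, Matrix.sub_apply, h00, h01, h10, h11]
  simp only [Matrix.one_apply, if_true, zero_ne_one, one_ne_zero, if_false, sub_zero, abs_zero]
  linarith

theorem integral_sq_integral_le_of_decay {P : Measure ℝ} [IsFiniteMeasure P] {D : ℝ → ℝ → ℝ}
    (hD : Continuous (Function.uncurry D)) {B : ℝ} (hB : ∀ t θ, |D t θ| ≤ B) {C : ℝ}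
    (hC0 : 0 ≤ C) (hC : ∀ t t', 0 ≤ t → 0 ≤ t' →
      |∫ θ, D t θ * D t' θ ∂P| ≤ C * (1 + (t - t') ^ 2)⁻¹) {T : ℝ} (hT : 0 ≤ T) :
    ∫ θ, (∫ t in (0 : ℝ)..T, D t θ) ^ 2 ∂P ≤ C * π * T := by
  set μ : Measure ℝ := volume.restrict (Set.Ioc 0 T) with hμ
  have hB0 : 0 ≤ B := (abs_nonneg _).trans (hB 0 0)
  have hcont : Continuous fun q : ℝ × (ℝ × ℝ) => D q.2.1 q.1 * D q.2.2 q.1 :=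
    (hD.comp (f := fun q : ℝ × (ℝ × ℝ) => (q.2.1, q.1)) (by fun_prop)).mul
      (hD.comp (f := fun q : ℝ × (ℝ × ℝ) => (q.2.2, q.1)) (by fun_prop))
  have hint : Integrable (Function.uncurry fun (θ : ℝ) (q : ℝ × ℝ) => D q.1 θ * D q.2 θ)
      (P.prod (μ.prod μ)) := by
    refine Integrable.of_bound hcont.aestronglyMeasurable (B * B) (ae_of_all _ fun q => ?_)
    simp only [Function.uncurry, norm_mul, Real.norm_eq_abs]
    exact mul_le_mul (hB _ _) (hB _ _) (abs_nonneg _) hB0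
  have hsq : ∀ θ, (∫ t in (0 : ℝ)..T, D t θ) ^ 2
      = ∫ q, D q.1 θ * D q.2 θ ∂(μ.prod μ) := fun θ => by
    rw [intervalIntegral.integral_of_le hT, sq]
    exact (integral_prod_mul (μ := μ) (ν := μ) (fun t => D t θ) (fun t => D t θ)).symm
  simp_rw [hsq]
  rw [integral_integral_swap hint]
  have hkernel : Continuous fun q : ℝ × ℝ => C * (1 + (q.1 - q.2) ^ 2)⁻¹ :=
    continuous_const.mul (Continuous.inv₀ (by fun_prop) fun q => by positivity)
  have hkint : Integrable (fun q : ℝ × ℝ => C * (1 + (q.1 - q.2) ^ 2)⁻¹) (μ.prod μ) := by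
    refine Integrable.of_bound hkernel.aestronglyMeasurable C (ae_of_all _ fun q => ?_)
    rw [Real.norm_eq_abs, abs_of_nonneg (by positivity)]
    exact mul_le_of_le_one_right hC0 (inv_le_one_of_one_le₀ (by nlinarith [sq_nonneg (q.1 - q.2)]))
  have hpos : ∀ᵐ q ∂(μ.prod μ), 0 ≤ q.1 ∧ 0 ≤ q.2 := by
    rw [hμ, Measure.prod_restrict]
    filter_upwards [ae_restrict_mem (measurableSet_Ioc.prod measurableSet_Ioc)] with q hq
    exact ⟨hq.1.1.le, hq.2.1.le⟩
  calc ∫ q, ∫ θ, D q.1 θ * D q.2 θ ∂P ∂(μ.prod μ)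
      ≤ ∫ q, C * (1 + (q.1 - q.2) ^ 2)⁻¹ ∂(μ.prod μ) := by
        refine integral_mono_ae hint.integral_prod_right hkint ?_
        filter_upwards [hpos] with q hq
        exact (le_abs_self _).trans (hC _ _ hq.1 hq.2)
    _ = ∫ t, ∫ t', C * (1 + (t - t') ^ 2)⁻¹ ∂μ ∂μ := integral_prod _ hkint
    _ ≤ ∫ _t, C * π ∂μ := by
        refine integral_mono hkint.integral_prod_left (integrable_const _) fun t => ?_
        have hi : Integrable fun t' : ℝ => (1 + (t - t') ^ 2)⁻¹ :=
          integrable_inv_one_add_sq.comp_sub_left t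
        have hle : ∫ t' in Set.Ioc 0 T, (1 + (t - t') ^ 2)⁻¹ ≤ π := by
          rw [← integral_univ_inv_one_add_sq,
            ← integral_sub_left_eq_self (fun u : ℝ => (1 + u ^ 2)⁻¹) volume t]
          exact setIntegral_le_integral hi (ae_of_all _ fun t' => by positivity)
        simp only [integral_const_mul]
        exact mul_le_mul_of_nonneg_left hle hC0
    _ = C * π * T := by
        simp [hμ, hT, mul_comm]

theorem ae_tendsto_zero_of_summable_integral {α : Type*} [MeasurableSpace α] {P : Measure α}
    {f : ℕ → α → ℝ} (hf : ∀ n, Integrable (f n) P) (hf0 : ∀ n a, 0 ≤ f n a)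
    (hs : Summable fun n => ∫ a, f n a ∂P) :
    ∀ᵐ a ∂P, Tendsto (fun n => f n a) atTop (𝓝 0) := by
  have hmeas : ∀ n, AEMeasurable (fun a => ENNReal.ofReal (f n a)) P := fun n =>
    (hf n).aestronglyMeasurable.aemeasurable.ennreal_ofReal
  have hfin : ∫⁻ a, ∑' n, ENNReal.ofReal (f n a) ∂P ≠ ⊤ := by
    rw [lintegral_tsum hmeas]
    simp_rw [← ofReal_integral_eq_lintegral_ofReal (hf _) (ae_of_all _ (hf0 _))]
    exact hs.tsum_ofReal_ne_top
  filter_upwards [ae_lt_top' (AEMeasurable.tsum hmeas) hfin] with a ha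
  have := ENNReal.tendsto_atTop_zero_of_tsum_ne_top ha.ne
  have h2 := (ENNReal.tendsto_toReal ENNReal.zero_ne_top).comp this
  simpa [Function.comp_def, ENNReal.toReal_ofReal (hf0 _ a)] using h2

theorem tendsto_average_of_tendsto_average_sq {S : ℝ → ℝ} {B : ℝ}
    (hS : ∀ a b, |S b - S a| ≤ B * |b - a|)
    (hsq : Tendsto (fun n : ℕ => ((n : ℝ) ^ 2)⁻¹ * S ((n : ℝ) ^ 2)) atTop (𝓝 0)) :
    Tendsto (fun T => T⁻¹ * S T) atTop (𝓝 0) := by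
  have hB : 0 ≤ B := by simpa using (abs_nonneg _).trans (hS 0 1)
  have hlim : Tendsto (fun n : ℕ => |((n : ℝ) ^ 2)⁻¹ * S ((n : ℝ) ^ 2)| + 3 * B * (n : ℝ)⁻¹)
      atTop (𝓝 0) := by
    have := hsq.abs.add (tendsto_inv_atTop_nhds_zero_nat (𝕜 := ℝ) |>.const_mul (3 * B))
    simpa using this
  have hfl : Tendsto (fun T : ℝ => ⌊√T⌋₊) atTop atTop :=
    tendsto_nat_floor_atTop.comp Real.tendsto_sqrt_atTop
  refine squeeze_zero_norm' ?_ (hlim.comp hfl)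
  filter_upwards [eventually_ge_atTop 1] with T hT
  set n := ⌊√T⌋₊ with hn
  have hs1 : 1 ≤ √T := Real.one_le_sqrt.2 hT
  have hn1 : (1 : ℝ) ≤ n := by exact_mod_cast Nat.le_floor (by simpa using hs1)
  have h1 : (n : ℝ) ≤ √T := Nat.floor_le (by positivity)
  have h2 : √T < n + 1 := Nat.lt_floor_add_one _
  have hTT : √T * √T = T := Real.mul_self_sqrt (by linarith)
  have hlow : (n : ℝ) ^ 2 ≤ T := by nlinarith
  have hup : T ≤ (n : ℝ) ^ 2 + 3 * n := by nlinarith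
  have hd : |S T| ≤ |S ((n : ℝ) ^ 2)| + B * (3 * n) := by
    have h3 := hS ((n : ℝ) ^ 2) T
    rw [abs_of_nonneg (sub_nonneg.2 hlow)] at h3
    have h4 : |S T| ≤ |S ((n : ℝ) ^ 2)| + |S T - S ((n : ℝ) ^ 2)| := by
      linarith [abs_sub_abs_le_abs_sub (S T) (S ((n : ℝ) ^ 2))]
    have h5 : B * (T - (n : ℝ) ^ 2) ≤ B * (3 * n) := by gcongr; linarith
    linarith
  have hn2 : (0 : ℝ) < (n : ℝ) ^ 2 := by positivity
  rw [Real.norm_eq_abs, abs_mul, abs_of_pos (inv_pos.2 (by linarith : (0:ℝ) < T))]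
  calc T⁻¹ * |S T| ≤ ((n : ℝ) ^ 2)⁻¹ * (|S ((n : ℝ) ^ 2)| + B * (3 * n)) := by
        gcongr
    _ = _ := by
        simp only [Function.comp, abs_mul, abs_of_pos (inv_pos.2 hn2), ← hn]
        field_simp

theorem ae_tendsto_average_of_decay {P : Measure ℝ} [IsFiniteMeasure P] {D : ℝ → ℝ → ℝ}
    (hD : Continuous (Function.uncurry D)) {B : ℝ} (hB : ∀ t θ, |D t θ| ≤ B) {C : ℝ}
    (hC0 : 0 ≤ C) (hC : ∀ t t', 0 ≤ t → 0 ≤ t' →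
      |∫ θ, D t θ * D t' θ ∂P| ≤ C * (1 + (t - t') ^ 2)⁻¹) :
    ∀ᵐ θ ∂P, Tendsto (fun T : ℝ => T⁻¹ * ∫ t in (0 : ℝ)..T, D t θ) atTop (𝓝 0) := by
  have hB0 : 0 ≤ B := (abs_nonneg _).trans (hB 0 0)
  have hDt : ∀ θ, Continuous fun t => D t θ := fun θ =>
    hD.comp (f := fun t : ℝ => (t, θ)) (by fun_prop)
  have hlip : ∀ θ a b, |(∫ t in (0 : ℝ)..b, D t θ) - ∫ t in (0 : ℝ)..a, D t θ| ≤ B * |b - a| :=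
    fun θ a b => by
      rw [intervalIntegral.integral_interval_sub_left ((hDt θ).intervalIntegrable _ _)
        ((hDt θ).intervalIntegrable _ _)]
      exact intervalIntegral.norm_integral_le_of_norm_le_const (f := fun t => D t θ)
        fun t _ => hB t θ
  have hcont : ∀ T : ℝ, Continuous fun θ => ∫ t in (0 : ℝ)..T, D t θ := fun T =>
    intervalIntegral.continuous_parametric_intervalIntegral_of_continuous'
      (f := fun θ t => D t θ) (hD.comp continuous_swap) 0 T
  have hsq := ae_tendsto_zero_of_summable_integral (P := P)
    (f := fun (n : ℕ) θ => (((n : ℝ) ^ 2)⁻¹ * ∫ t in (0 : ℝ)..(n : ℝ) ^ 2, D t θ) ^ 2)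
    (fun n => by
      refine Integrable.of_bound ((continuous_const.mul (hcont _)).pow 2).aestronglyMeasurable
        (B ^ 2) (ae_of_all _ fun θ => ?_)
      have h1 := hlip θ 0 ((n : ℝ) ^ 2)
      simp only [intervalIntegral.integral_same, sub_zero] at h1
      rw [norm_pow, norm_mul, norm_inv, Real.norm_eq_abs, Real.norm_eq_abs]
      gcongr
      rcases eq_or_lt_of_le (abs_nonneg ((n : ℝ) ^ 2)) with h0 | h0
      · rw [← h0]; simpa using hB0
      · rw [inv_mul_le_iff₀ h0]; linarith)
    (fun n θ => sq_nonneg _)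
    (by
      refine Summable.of_nonneg_of_le (fun n => integral_nonneg fun θ => sq_nonneg _)
        (fun n => ?_) ((Real.summable_nat_pow_inv.2 one_lt_two).mul_left (C * π))
      simp_rw [mul_pow]
      rw [integral_const_mul]
      have := integral_sq_integral_le_of_decay hD hB hC0 hC (sq_nonneg (n : ℝ))
      rcases eq_or_ne (n : ℝ) 0 with h0 | h0
      · simp [h0]
      · calc _ ≤ (((n : ℝ) ^ 2)⁻¹) ^ 2 * (C * π * (n : ℝ) ^ 2) := by gcongr
          _ = _ := by field_simp)
  filter_upwards [hsq] with θ hθ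
  refine tendsto_average_of_tendsto_average_sq (hlip θ) ?_
  have := hθ.sqrt
  simp only [Real.sqrt_sq_eq_abs, Real.sqrt_zero] at this
  exact (tendsto_zero_iff_abs_tendsto_zero _).2 this

theorem abs_integral_mul_shift_sub_le {f g : ℝ → ℝ} (hf : Continuous f) (hg : Continuous g)
    {p : ℝ} (hp : 0 ≤ p) (hfp : Function.Periodic f p) (hgp : Function.Periodic g p) {K B : ℝ}
    (hK : ∀ θ δ, |f (θ + δ) - f θ| ≤ K * |δ|) (hB : ∀ θ, |g θ| ≤ B) (a : ℝ) :
    |∫ θ in (0 : ℝ)..p, f θ * (g (θ + a) - g θ)| ≤ K * |a| * B * p := by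
  have hshift : ∫ θ in (0 : ℝ)..p, f θ * g (θ + a) = ∫ θ in (0 : ℝ)..p, f (θ - a) * g θ := by
    have hper : Function.Periodic (fun θ => f (θ - a) * g θ) p := fun θ => by
      simp only [hgp θ]
      rw [show θ + p - a = θ - a + p by ring, hfp]
    have h1 := intervalIntegral.integral_comp_add_right (a := 0) (b := p)
      (fun θ => f (θ - a) * g θ) a
    simp only [add_sub_cancel_right] at h1
    rw [h1, zero_add, add_comm p a, hper.intervalIntegral_add_eq a 0, zero_add]
  have hrw : ∫ θ in (0 : ℝ)..p, f θ * (g (θ + a) - g θ)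
      = ∫ θ in (0 : ℝ)..p, (f (θ - a) - f θ) * g θ := by
    simp only [mul_sub, sub_mul]
    rw [intervalIntegral.integral_sub, intervalIntegral.integral_sub, hshift] <;>
    · apply Continuous.intervalIntegrable
      fun_prop
  rw [hrw]
  have := intervalIntegral.norm_integral_le_of_norm_le_const (a := 0) (b := p)
    (f := fun θ => (f (θ - a) - f θ) * g θ) (C := K * |a| * B) fun θ _ => by
      rw [norm_mul]
      have h1 := hK θ (-a)
      rw [abs_neg, ← sub_eq_add_neg] at h1
      exact mul_le_mul h1 (hB θ) (abs_nonneg _) ((abs_nonneg _).trans h1)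
  rwa [sub_zero, abs_of_nonneg hp] at this

theorem exp_neg_two_mul_le_inv_one_add_sq {u : ℝ} (hu : 0 ≤ u) :
    Real.exp (-(2 * u)) ≤ (1 + u ^ 2)⁻¹ := by
  rw [Real.exp_neg]
  gcongr
  have := Real.quadratic_le_exp_of_nonneg (mul_nonneg zero_le_two hu)
  nlinarith

section Orbit

variable {X : Type*} [MulAction SL2 X]

theorem continuous_orbit [TopologicalSpace X]
    (hact : Continuous fun p : SL2 × X => p.1 • p.2) (x : X)
    {φ : X → ℝ} (hφ : Continuous φ) :
    Continuous (Function.uncurry fun t θ => φ ((gMat t * rMat θ) • x)) :=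
  hφ.comp (hact.comp (continuous_gMat_mul_rMat.prodMk continuous_const))

theorem abs_orbit_shift_sub_le {φ : X → ℝ} {L : ℝ} (hL0 : 0 ≤ L)
    (hL : ∀ (h : SL2) (y : X),
      |φ (h • y) - φ y| ≤ L * entryNorm ((h : Matrix (Fin 2) (Fin 2) ℝ) - 1))
    (x : X) {t : ℝ} (ht : 0 ≤ t) (θ δ : ℝ) :
    |φ ((gMat t * rMat (θ + δ)) • x) - φ ((gMat t * rMat θ) • x)|
      ≤ L * (4 * Real.exp (2 * t) * |δ|) := by
  have hg : gMat (-t) * gMat t = 1 := by rw [← gMat_add, neg_add_cancel, gMat_zero]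
  have heq : gMat t * rMat (θ + δ)
      = (gMat t * rMat δ * gMat (-t)) * (gMat t * rMat θ) := by
    rw [add_comm, rMat_add]
    simp only [mul_assoc]
    rw [← mul_assoc (gMat (-t)), hg, one_mul]
  rw [heq, mul_smul]
  exact (hL _ _).trans (by gcongr; exact entryNorm_gMat_conj_rMat_sub_one_le ht δ)

theorem abs_uMat_orbit_sub_le {φ : X → ℝ} {L : ℝ} (hL0 : 0 ≤ L)
    (hL : ∀ (h : SL2) (y : X),
      |φ (h • y) - φ y| ≤ L * entryNorm ((h : Matrix (Fin 2) (Fin 2) ℝ) - 1))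
    (x : X) {t : ℝ} (ht : 0 ≤ t) (θ : ℝ) :
    |φ (uMat 1 • (gMat t * rMat θ) • x)
      - φ ((gMat t * rMat (θ + Real.arctan (Real.exp (-(2 * t))))) • x)|
      ≤ L * (3 * Real.exp (-(2 * t))) := by
  set ε := Real.arctan (Real.exp (-(2 * t)))
  have hg : gMat (-t) * gMat t = 1 := by rw [← gMat_add, neg_add_cancel, gMat_zero]
  have heq : uMat 1 * (gMat t * rMat θ)
      = (uMat 1 * (gMat t * rMat (-ε) * gMat (-t))) * (gMat t * rMat (θ + ε)) := by
    conv_lhs => rw [show θ = -ε + (θ + ε) by ring, rMat_add]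
    simp only [mul_assoc]
    rw [← mul_assoc (gMat (-t)), hg, one_mul]
  rw [smul_smul, heq, mul_smul]
  exact (hL _ _).trans
    (by gcongr; exact entryNorm_uMat_mul_gMat_conj_rMat_sub_one_le ht)

theorem ae_tendsto_average_uMat_sub [TopologicalSpace X]
    (hact : Continuous fun p : SL2 × X => p.1 • p.2)
    {φ : X → ℝ} (hφ : Continuous φ) {B L : ℝ} (hB : ∀ y, |φ y| ≤ B) (hL0 : 0 ≤ L)
    (hL : ∀ (h : SL2) (y : X),
      |φ (h • y) - φ y| ≤ L * entryNorm ((h : Matrix (Fin 2) (Fin 2) ℝ) - 1))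
    (x : X) :
    ∀ᵐ θ ∂(volume.restrict (Set.Icc (0:ℝ) (2 * π))),
      Tendsto (fun T : ℝ => T⁻¹ * ∫ t in (0 : ℝ)..T,
        (φ (uMat 1 • (gMat t * rMat θ) • x) - φ ((gMat t * rMat θ) • x))) atTop (𝓝 0) := by
  set F : ℝ → ℝ → ℝ := fun t θ => φ ((gMat t * rMat θ) • x) with hF
  set ε : ℝ → ℝ := fun t => Real.arctan (Real.exp (-(2 * t))) with hε
  set D : ℝ → ℝ → ℝ := fun t θ => F t (θ + ε t) - F t θ with hD
  have hFc : Continuous (Function.uncurry F) := continuous_orbit hact x hφ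
  have hεc : Continuous ε := Real.continuous_arctan.comp (by fun_prop)
  have hε0 : ∀ t, 0 ≤ ε t := fun t => Real.arctan_nonneg.2 (Real.exp_pos _).le
  have hεle : ∀ t, ε t ≤ Real.exp (-(2 * t)) := fun t =>
    arctan_le_self_of_nonneg (Real.exp_pos _).le
  have hDc : Continuous (Function.uncurry D) :=
    (hFc.comp (f := fun q : ℝ × ℝ => (q.1, q.2 + ε q.1)) (by fun_prop)).sub hFc
  have hFB : ∀ t θ, |F t θ| ≤ B := fun t θ => hB _
  have hB0 : 0 ≤ B := (abs_nonneg _).trans (hB x)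
  have hDB : ∀ t θ, |D t θ| ≤ 2 * B := fun t θ => by
    linarith [abs_sub (F t (θ + ε t)) (F t θ), hFB t θ, hFB t (θ + ε t)]
  have hFper : ∀ t, Function.Periodic (F t) (2 * π) := fun t θ => by
    simp only [hF, rMat_add_two_pi]
  have hDper : ∀ t, Function.Periodic (D t) (2 * π) := fun t θ => by
    simp only [hD]
    rw [show θ + 2 * π + ε t = θ + ε t + 2 * π by ring, hFper, hFper]
  have hDlip : ∀ t, 0 ≤ t → ∀ θ δ, |D t (θ + δ) - D t θ| ≤ (8 * L * Real.exp (2 * t)) * |δ| :=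
    fun t ht θ δ => by
      have h1 := abs_orbit_shift_sub_le hL0 hL x ht θ δ
      have h2 := abs_orbit_shift_sub_le hL0 hL x ht (θ + ε t) δ
      have h3 : D t (θ + δ) - D t θ
          = (F t (θ + ε t + δ) - F t (θ + ε t)) - (F t (θ + δ) - F t θ) := by
        simp only [hD]
        rw [show θ + δ + ε t = θ + ε t + δ by ring]
        ring
      rw [h3]
      linarith [abs_sub (F t (θ + ε t + δ) - F t (θ + ε t)) (F t (θ + δ) - F t θ)]
  have hFt : ∀ t, Continuous (F t) := fun t => hFc.comp (f := fun θ : ℝ => (t, θ)) (by fun_prop)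
  have hDt : ∀ t, Continuous (D t) := fun t => hDc.comp (f := fun θ : ℝ => (t, θ)) (by fun_prop)
  have hint : ∀ f : ℝ → ℝ, ∫ θ in Set.Icc (0 : ℝ) (2 * π), f θ = ∫ θ in (0 : ℝ)..(2 * π), f θ :=
    fun f => by
      rw [integral_Icc_eq_integral_Ioc, intervalIntegral.integral_of_le Real.two_pi_pos.le]
  have hcorr : ∀ t t', 0 ≤ t → t ≤ t' →
      |∫ θ in Set.Icc (0 : ℝ) (2 * π), D t θ * D t' θ|
        ≤ (8 * L * B * (2 * π)) * (1 + (t - t') ^ 2)⁻¹ := fun t t' ht htt' => by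
    rw [hint]
    refine (abs_integral_mul_shift_sub_le (hDt t) (hFt t') Real.two_pi_pos.le (hDper t)
      (hFper t') (hDlip t ht) (hFB t') (ε t')).trans ?_
    rw [abs_of_nonneg (hε0 t')]
    have h1 : Real.exp (2 * t) * ε t' ≤ (1 + (t - t') ^ 2)⁻¹ := by
      calc Real.exp (2 * t) * ε t' ≤ Real.exp (2 * t) * Real.exp (-(2 * t')) := by
            gcongr; exact hεle t'
        _ = Real.exp (-(2 * (t' - t))) := by rw [← Real.exp_add]; ring_nf
        _ ≤ _ := by
          have := exp_neg_two_mul_le_inv_one_add_sq (sub_nonneg.2 htt')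
          rwa [← neg_sub t t', neg_sq, neg_sub] at this
    calc _ = (8 * L * B * (2 * π)) * (Real.exp (2 * t) * ε t') := by ring
      _ ≤ _ := by gcongr
  have hmain := ae_tendsto_average_of_decay (P := volume.restrict (Set.Icc (0:ℝ) (2 * π)))
    hDc hDB (C := 8 * L * B * (2 * π)) (by positivity) fun t t' ht ht' => by
      rcases le_total t t' with h | h
      · exact hcorr t t' ht h
      · have := hcorr t' t ht' h
        rw [← neg_sub t t', neg_sq] at this
        simpa only [mul_comm (D t _)] using this
  filter_upwards [hmain] with θ hθ
  have hus : Continuous fun t => φ (uMat 1 • (gMat t * rMat θ) • x) :=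
    hφ.comp (hact.comp (continuous_const.prodMk
      (hact.comp ((continuous_gMat_mul_rMat.comp
        (f := fun t : ℝ => (t, θ)) (by fun_prop)).prodMk continuous_const))))
  have hFθ : ∀ f : ℝ → ℝ, Continuous f → Continuous fun t => F t (f t) := fun f hf =>
    hFc.comp (f := fun t : ℝ => (t, f t)) (by fun_prop)
  have hsplit : ∀ T, (∫ t in (0 : ℝ)..T,
        (φ (uMat 1 • (gMat t * rMat θ) • x) - φ ((gMat t * rMat θ) • x)))
      = (∫ t in (0 : ℝ)..T, (φ (uMat 1 • (gMat t * rMat θ) • x) - F t (θ + ε t)))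
        + ∫ t in (0 : ℝ)..T, D t θ := fun T => by
    rw [← intervalIntegral.integral_add]
    · simp [hD, hF]
    · exact (hus.sub (hFθ _ (by fun_prop))).intervalIntegrable _ _
    · exact ((hFθ _ (by fun_prop)).sub (hFθ _ (by fun_prop))).intervalIntegrable _ _
  simp_rw [hsplit, mul_add]
  rw [show 𝓝 (0 : ℝ) = 𝓝 (0 + 0) by rw [add_zero]]
  refine Tendsto.add ?_ hθ
  refine squeeze_zero_norm' (a := fun T : ℝ => T⁻¹ * (3 * L * π)) ?_
    (by simpa using tendsto_inv_atTop_zero.mul_const (3 * L * π))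
  filter_upwards [eventually_gt_atTop 0] with T hT
  rw [norm_mul, norm_inv, Real.norm_eq_abs T, abs_of_pos hT]
  gcongr
  have hbd : IntervalIntegrable (fun t : ℝ => 3 * L * (1 + t ^ 2)⁻¹) volume 0 T :=
    (integrable_inv_one_add_sq.const_mul _).intervalIntegrable
  refine (intervalIntegral.norm_integral_le_of_norm_le hT.le (ae_of_all _ fun t ht => ?_)
    hbd).trans ?_
  · refine (abs_uMat_orbit_sub_le hL0 hL x ht.1.le θ).trans ?_
    have := exp_neg_two_mul_le_inv_one_add_sq ht.1.le
    calc _ = 3 * L * Real.exp (-(2 * t)) := by ring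
      _ ≤ _ := by gcongr
  · rw [intervalIntegral.integral_const_mul]
    gcongr
    rw [intervalIntegral.integral_of_le hT.le, ← integral_univ_inv_one_add_sq]
    exact setIntegral_le_integral integrable_inv_one_add_sq (ae_of_all _ fun t => by positivity)

end Orbit

theorem TopologicalSpace.exists_countable_isPiSystem_isCompact_closure (X : Type*)
    [TopologicalSpace X] [R1Space X] [SecondCountableTopology X] [LocallyCompactSpace X]
    [MeasurableSpace X] [BorelSpace X] :
    ∃ C : Set (Set X), C.Countable ∧ IsPiSystem C ∧
      ‹MeasurableSpace X› = MeasurableSpace.generateFrom C ∧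
      ∀ O ∈ C, IsOpen O ∧ IsCompact (closure O) := by
  let b := TopologicalSpace.countableBasis X
  have hb : TopologicalSpace.IsTopologicalBasis b := TopologicalSpace.isBasis_countableBasis X
  let b' : Set (Set X) := {U ∈ b | IsCompact (closure U)}
  have hb'c : b'.Countable :=
    (TopologicalSpace.countable_countableBasis X).mono (Set.sep_subset _ _)
  have hb' : TopologicalSpace.IsTopologicalBasis b' := by
    refine TopologicalSpace.isTopologicalBasis_of_isOpen_of_nhds
      (fun U hU => hb.isOpen hU.1) fun y V hy hV => ?_
    obtain ⟨K, hK, hyK, -⟩ := exists_compact_subset isOpen_univ (Set.mem_univ y)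
    obtain ⟨U, hU, hyU, hUV⟩ := hb.exists_subset_of_mem_open
      (show y ∈ V ∩ interior K from ⟨hy, hyK⟩) (hV.inter isOpen_interior)
    refine ⟨U, ⟨hU, ?_⟩, hyU, hUV.trans Set.inter_subset_left⟩
    exact hK.closure_of_subset ((hUV.trans Set.inter_subset_right).trans interior_subset)
  refine ⟨Set.image Set.sInter {F | F.Finite ∧ F.Nonempty ∧ F ⊆ b'}, ?_, ?_, ?_, ?_⟩
  · refine Set.Countable.image ?_ _
    have : {F | F.Finite ∧ F ⊆ b'}.Countable := Set.countable_ofPred_finite_subset hb'c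
    exact this.mono fun F (hF : F.Finite ∧ F.Nonempty ∧ F ⊆ b') =>
      show F.Finite ∧ F ⊆ b' from ⟨hF.1, hF.2.2⟩
  · rintro _ ⟨F, hF, rfl⟩ _ ⟨G, hG, rfl⟩ -
    exact ⟨F ∪ G, ⟨hF.1.union hG.1, hF.2.1.mono Set.subset_union_left,
      Set.union_subset hF.2.2 hG.2.2⟩, Set.sInter_union F G⟩
  · apply le_antisymm
    · rw [BorelSpace.measurable_eq (α := X), hb'.borel_eq_generateFrom]
      exact MeasurableSpace.generateFrom_mono fun U hU =>
        ⟨{U}, ⟨Set.finite_singleton U, Set.singleton_nonempty U,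
          Set.singleton_subset_iff.2 hU⟩, Set.sInter_singleton U⟩
    · refine MeasurableSpace.generateFrom_le ?_
      rintro _ ⟨F, hF, rfl⟩
      exact (hF.1.isOpen_sInter fun U hU => hb'.isOpen (hF.2.2 hU)).measurableSet
  · rintro _ ⟨F, hF, rfl⟩
    refine ⟨hF.1.isOpen_sInter fun U hU => hb'.isOpen (hF.2.2 hU), ?_⟩
    obtain ⟨U, hU⟩ := hF.2.1
    exact (hF.2.2 hU).2.of_isClosed_subset isClosed_closure
      (closure_mono (Set.sInter_subset_of_mem hU))

theorem exists_countable_lipschitz_separating (X : Type*) [MetricSpace X]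
    [SecondCountableTopology X] [LocallyCompactSpace X] [MeasurableSpace X] [BorelSpace X] :
    ∃ S : Set (X → ℝ), S.Countable ∧
      (∀ φ ∈ S, (∃ κ, LipschitzWith κ φ) ∧ HasCompactSupport φ ∧ ∀ y, |φ y| ≤ 1) ∧
      ∀ (μ ν : Measure X) [IsFiniteMeasure μ] [IsFiniteMeasure ν], μ Set.univ = ν Set.univ →
        (∀ φ ∈ S, ∫ y, φ y ∂μ = ∫ y, φ y ∂ν) → μ = ν := by
  obtain ⟨C, hCc, hCpi, hCgen, hCO⟩ :=
    TopologicalSpace.exists_countable_isPiSystem_isCompact_closure X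
  let f : Set X → ℕ → X → ℝ := fun O n y => min 1 (n * Metric.infDist y Oᶜ)
  have hf0 : ∀ O n y, 0 ≤ f O n y := fun O n y =>
    le_min zero_le_one (mul_nonneg n.cast_nonneg Metric.infDist_nonneg)
  have hf1 : ∀ O n y, |f O n y| ≤ 1 := fun O n y => by
    rw [abs_of_nonneg (hf0 O n y)]
    exact min_le_left _ _
  have hfl : ∀ O n, ∃ κ, LipschitzWith κ (f O n) := fun O n =>
    ⟨_, ((lipschitzWith_smul (n : ℝ)).comp (Metric.lipschitz_infDist_pt Oᶜ)).const_min 1⟩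
  have hfout : ∀ O n y, y ∉ O → f O n y = 0 := fun O n y hy => by
    simp [f, Metric.infDist_zero_of_mem (show y ∈ Oᶜ from hy)]
  refine ⟨Set.image2 f C Set.univ, hCc.image2 Set.countable_univ f, ?_, ?_⟩
  · rintro _ ⟨O, hO, n, -, rfl⟩
    refine ⟨hfl O n, ?_, hf1 O n⟩
    exact HasCompactSupport.intro (hCO O hO).2 fun y hy =>
      hfout O n y fun h => hy (subset_closure h)
  · intro μ ν _ _ huniv hint
    refine ext_of_generate_finite C hCgen hCpi (fun O hO => ?_) huniv
    by_cases hOu : O = Set.univ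
    · rw [hOu, huniv]
    have hne : (Oᶜ).Nonempty := Set.nonempty_compl.2 hOu
    have hlim : ∀ (ρ : Measure X) [IsFiniteMeasure ρ],
        Tendsto (fun n => ∫ y, f O n y ∂ρ) atTop (𝓝 (ρ.real O)) := by
      intro ρ _
      rw [← integral_indicator_one (hCO O hO).1.measurableSet]
      refine tendsto_integral_of_dominated_convergence (fun _ => 1)
        (fun n => (hfl O n).choose_spec.continuous.aestronglyMeasurable)
        (integrable_const _) (fun n => ae_of_all _ (hf1 O n)) (ae_of_all _ fun y => ?_)
      by_cases hy : y ∈ O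
      · have hd : 0 < Metric.infDist y Oᶜ :=
          ((hCO O hO).1.isClosed_compl.notMem_iff_infDist_pos hne).1 (by simpa using hy)
        rw [Set.indicator_of_mem hy]
        refine tendsto_const_nhds.congr' ?_
        filter_upwards [(tendsto_natCast_atTop_atTop.atTop_mul_const hd).eventually_ge_atTop 1]
          with n hn
        exact (min_eq_left hn).symm
      · simp [hfout O _ y hy, hy]
    have heq := tendsto_nhds_unique (hlim μ)
      ((hlim ν).congr fun n => (hint _ ⟨O, hO, n, trivial, rfl⟩).symm)
    exact (measureReal_eq_measureReal_iff).1 heq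

theorem tendsto_average_shift_sub {f : ℝ → ℝ} (hf : Continuous f) {B : ℝ}
    (hB : ∀ t, |f t| ≤ B) (τ : ℝ) :
    Tendsto (fun T : ℝ => T⁻¹ * ∫ t in (0 : ℝ)..T, (f (τ + t) - f t)) atTop (𝓝 0) := by
  have hi : ∀ a b, IntervalIntegrable f volume a b := fun a b => hf.intervalIntegrable a b
  have hbd : ∀ a b, |∫ t in a..b, f t| ≤ B * |b - a| := fun a b =>
    intervalIntegral.norm_integral_le_of_norm_le_const (f := f) fun t _ => hB t
  refine squeeze_zero_norm' (a := fun T : ℝ => T⁻¹ * (2 * B * |τ|)) ?_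
    (by simpa using tendsto_inv_atTop_zero.mul_const (2 * B * |τ|))
  filter_upwards [eventually_gt_atTop 0] with T hT
  rw [norm_mul, norm_inv, Real.norm_eq_abs T, abs_of_pos hT]
  gcongr
  have hshift : IntervalIntegrable (fun t => f (τ + t)) volume 0 T :=
    Continuous.intervalIntegrable (by fun_prop) _ _
  rw [intervalIntegral.integral_sub hshift (hi _ _),
    intervalIntegral.integral_comp_add_left (fun t => f t), add_zero,
    intervalIntegral.integral_interval_sub_interval_comm (hi _ _) (hi _ _) (hi _ _)]
  have h1 := hbd τ 0
  have h2 := hbd (τ + T) T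
  rw [Real.norm_eq_abs]
  refine (abs_sub _ _).trans ?_
  rw [show (0 : ℝ) - τ = -τ by ring, abs_neg] at h1
  rw [show T - (τ + T) = -τ by ring, abs_neg] at h2
  linarith

section Invariance

variable {X : Type*} [MeasurableSpace X] [MulAction SL2 X] {ν : Measure X}

theorem map_smul_mul_eq (hm : ∀ h : SL2, Measurable fun y : X => h • y) {g h : SL2}
    (hg : ν.map (g • ·) = ν) (hh : ν.map (h • ·) = ν) : ν.map ((g * h) • ·) = ν := by
  have : (fun y : X => (g * h) • y) = (g • ·) ∘ (h • ·) := funext fun y => mul_smul g h y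
  rw [this, ← Measure.map_map (hm g) (hm h), hh, hg]

theorem map_smul_inv_eq (hm : ∀ h : SL2, Measurable fun y : X => h • y) {g : SL2}
    (hg : ν.map (g • ·) = ν) : ν.map (g⁻¹ • ·) = ν := by
  conv_lhs => rw [← hg, Measure.map_map (hm _) (hm _)]
  simp [Function.comp_def]

theorem map_smul_eq_of_gMat_of_uMat_one (hm : ∀ h : SL2, Measurable fun y : X => h • y)
    (hg : ∀ t, ν.map (gMat t • ·) = ν) (hu : ν.map (uMat 1 • ·) = ν) {p : SL2}
    (h10 : (p : Matrix (Fin 2) (Fin 2) ℝ) 1 0 = 0)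
    (h00 : 0 < (p : Matrix (Fin 2) (Fin 2) ℝ) 0 0) : ν.map (p • ·) = ν := by
  have hpos : ∀ s, 0 < s → ν.map (uMat s • ·) = ν := fun s hs => by
    have heq : uMat s = gMat (Real.log s / 2) * uMat 1 * gMat (-(Real.log s / 2)) := by
      have e : Real.exp (Real.log s / 2) * Real.exp (Real.log s / 2) = s := by
        rw [← Real.exp_add, add_halves, Real.exp_log hs]
      ext i j
      fin_cases i <;> fin_cases j <;> simp [coe_gMat, coe_uMat, ← Real.exp_add, e]
    rw [heq]
    exact map_smul_mul_eq hm (map_smul_mul_eq hm (hg _) hu) (hg _)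
  have hall : ∀ s, ν.map (uMat s • ·) = ν := fun s => by
    rcases lt_trichotomy s 0 with hs | rfl | hs
    · have heq : uMat s = (uMat (-s))⁻¹ := by
        ext i j
        fin_cases i <;> fin_cases j <;> simp [coe_uMat, Matrix.adjugate_fin_two]
      rw [heq]
      exact map_smul_inv_eq hm (hpos _ (neg_pos.2 hs))
    · have heq : uMat 0 = 1 := by
        ext i j
        fin_cases i <;> fin_cases j <;> simp [coe_uMat]
      simp [heq]
    · exact hpos s hs
  have hdet : (p : Matrix (Fin 2) (Fin 2) ℝ) 0 0 * (p : Matrix (Fin 2) (Fin 2) ℝ) 1 1 = 1 := by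
    have := p.det_coe
    rwa [Matrix.det_fin_two, h10, mul_zero, sub_zero] at this
  have heq : p = gMat (Real.log ((p : Matrix (Fin 2) (Fin 2) ℝ) 0 0))
      * uMat ((p : Matrix (Fin 2) (Fin 2) ℝ) 0 1 / (p : Matrix (Fin 2) (Fin 2) ℝ) 0 0) := by
    ext i j
    fin_cases i <;> fin_cases j <;> simp [coe_gMat, coe_uMat, Real.exp_neg, Real.exp_log h00, h10]
    · field_simp
    · exact eq_inv_of_mul_eq_one_right hdet
  rw [heq]
  exact map_smul_mul_eq hm (hg _) (hall _)

end Invariance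

/-- Let `X` be a locally compact second-countable metric space with a
continuous `SL(2,ℝ)`-action which is locally Lipschitz in the group variable.  Fix `x ∈ X`.
For Lebesgue-almost every `θ ∈ [0, 2π]`: whenever `T_k → ∞` is a sequence of positive reals and
`ν_θ` is a finite Borel measure on `X` such that `φ ↦ (1/T_k) ∫₀^{T_k} φ(g_t r_θ · x) dt`
converges weak-* to `ν_θ`, then `ν_θ` is invariant under every upper triangular matrix in
`SL(2,ℝ)` with positive diagonal entries. -/
theorem stmt1 {X : Type*} [MetricSpace X] [SecondCountableTopology X] [LocallyCompactSpace X]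
    [MeasurableSpace X] [BorelSpace X] [MulAction SL2 X]
    (hact : Continuous fun p : SL2 × X => p.1 • p.2)
    (hlip : ∀ K : Set X, IsCompact K →
      ∃ C > (0:ℝ), ∃ U ∈ 𝓝 (1 : SL2), ∀ y ∈ K, ∀ h ∈ U,
        dist (h • y) y ≤ C * opNorm2 ((h : Matrix (Fin 2) (Fin 2) ℝ) - 1))
    (x : X) :
    ∀ᵐ θ ∂(volume.restrict (Set.Icc (0:ℝ) (2 * π))),
      ∀ T : ℕ → ℝ, (∀ k, 0 < T k) → Tendsto T atTop atTop →
        ∀ ν : Measure X, IsFiniteMeasure ν →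
          (∀ φ : X → ℝ, Continuous φ → HasCompactSupport φ →
              Tendsto (fun k => (T k)⁻¹ * ∫ t in (0:ℝ)..(T k), φ ((gMat t * rMat θ) • x))
                atTop (𝓝 (∫ y, φ y ∂ν))) →
          ∀ p : SL2, (p : Matrix (Fin 2) (Fin 2) ℝ) 1 0 = 0 →
            0 < (p : Matrix (Fin 2) (Fin 2) ℝ) 0 0 →
            0 < (p : Matrix (Fin 2) (Fin 2) ℝ) 1 1 →
            ∀ φ : X → ℝ, Continuous φ → HasCompactSupport φ →
              ∫ y, φ (p • y) ∂ν = ∫ y, φ y ∂ν := by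
  have hsmul : ∀ h : SL2, Continuous fun y : X => h • y := fun h =>
    hact.comp (continuous_const.prodMk continuous_id)
  have hm : ∀ h : SL2, Measurable fun y : X => h • y := fun h => (hsmul h).measurable
  obtain ⟨S, hSc, hS, hsep⟩ := exists_countable_lipschitz_separating X
  have hae : ∀ᵐ θ ∂(volume.restrict (Set.Icc (0:ℝ) (2 * π))), ∀ φ ∈ S,
      Tendsto (fun T : ℝ => T⁻¹ * ∫ t in (0 : ℝ)..T,
        (φ (uMat 1 • (gMat t * rMat θ) • x) - φ ((gMat t * rMat θ) • x))) atTop (𝓝 0) := by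
    refine (ae_ball_iff hSc).2 fun φ hφ => ?_
    obtain ⟨⟨κ, hκ⟩, hc, h1⟩ := hS φ hφ
    obtain ⟨L, hL0, hL⟩ := exists_abs_smul_sub_le hlip hκ hc h1
    exact ae_tendsto_average_uMat_sub hact hκ.continuous h1 hL0 hL x
  filter_upwards [hae] with θ hθ T _ hT ν hν hlim p h10 h00 _ φ hφ hφc
  have horb : Continuous fun t => (gMat t * rMat θ) • x :=
    hact.comp ((continuous_gMat_mul_rMat.comp (f := fun t : ℝ => (t, θ)) (by fun_prop)).prodMk
      continuous_const)
  have hinv : ∀ h : SL2, (∀ φ ∈ S, Tendsto (fun T : ℝ => T⁻¹ * ∫ t in (0 : ℝ)..T,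
        (φ (h • (gMat t * rMat θ) • x) - φ ((gMat t * rMat θ) • x))) atTop (𝓝 0)) →
      ν.map (h • ·) = ν := fun h hh => by
    have : IsFiniteMeasure (ν.map (h • ·)) := Measure.isFiniteMeasure_map ν _
    refine hsep _ _ ?_ fun ψ hψ => ?_
    · rw [Measure.map_apply (hm h) MeasurableSet.univ, Set.preimage_univ]
    obtain ⟨⟨κ, hκ⟩, hc, -⟩ := hS ψ hψ
    have hψc := hκ.continuous
    rw [integral_map (hm h).aemeasurable hψc.aestronglyMeasurable]
    have h1 := hlim ψ hψc hc
    have h2 := hlim (fun y => ψ (h • y)) (hψc.comp (hsmul h))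
      (hc.comp_homeomorph ⟨MulAction.toPerm h, hsmul h, hsmul h⁻¹⟩)
    refine sub_eq_zero.1 (tendsto_nhds_unique ((h2.sub h1).congr fun k => ?_)
      ((hh ψ hψ).comp hT))
    rw [Function.comp_apply, ← mul_sub, intervalIntegral.integral_sub]
    · exact (hψc.comp ((hsmul h).comp horb)).intervalIntegrable _ _
    · exact (hψc.comp horb).intervalIntegrable _ _
  have hg : ∀ τ, ν.map (gMat τ • ·) = ν := fun τ => hinv _ fun ψ hψ => by
    obtain ⟨⟨κ, hκ⟩, -, h1⟩ := hS ψ hψ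
    have := tendsto_average_shift_sub (hκ.continuous.comp horb) (fun t => h1 _) τ
    simpa only [Function.comp, gMat_add, mul_assoc, mul_smul] using this
  have hp := map_smul_eq_of_gMat_of_uMat_one hm hg (hinv _ hθ) h10 h00
  conv_rhs => rw [← hp]
  exact (integral_map (hm p).aemeasurable hφ.aestronglyMeasurable).symm
end

section
/- Let (f_t)_{t ≥ 0} be a family of functions f_t: [0, 2π] → ℝ, jointly measurable in (t, θ), such that: (i) there is B > 0 with |f_t(θ)| ≤ B for all t and θ; (ii) ∫₀^{2π} f_t(θ) dθ = 0 for every t ≥ 0; (iii) there exist C > 0 and λ > 0 with ∫₀^{2π} f_t(θ) f_s(θ) dθ ≤ C e^{−λ|s − t|} for all s, t ≥ 0; and (iv) there is M > 0 such that |f_t(θ) − f_s(θ)| ≤ 2M|t − s| for all s, t ≥ 0 and every θ. Then for Lebesgue-almost every θ ∈ [0, 2π], lim_{T → ∞} (1/T) ∫₀^T f_t(θ) dt = 0. -/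
open MeasureTheory Filter Topology Real

theorem integral_exp_neg_mul_abs {lam : ℝ} (hlam : 0 < lam) :
    ∫ x : ℝ, Real.exp (-lam * |x|) = 2 / lam := by
  rw [integral_comp_abs (f := fun x => Real.exp (-lam * x)),
    integral_exp_mul_Ioi (by linarith) 0]
  simp [div_eq_mul_inv]

theorem integrable_exp_neg_mul_abs {lam : ℝ} (hlam : 0 < lam) :
    Integrable fun x : ℝ => Real.exp (-lam * |x|) := by
  by_contra h
  have := integral_exp_neg_mul_abs hlam
  rw [integral_undef h] at this
  have h2 : 0 < 2 / lam := by positivity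
  linarith

/-- Exponentially decaying correlations make the second moment of the time integral grow at most
linearly. -/
theorem integral_sq_intervalIntegral_le {Ω : Type*} [MeasurableSpace Ω] {μ : Measure Ω}
    [IsFiniteMeasure μ] {g : ℝ → Ω → ℝ} (hg : Measurable (Function.uncurry g)) {B : ℝ}
    (hB : ∀ t ω, |g t ω| ≤ B) {C lam : ℝ} (hC : 0 ≤ C) (hlam : 0 < lam)
    (hcorr : ∀ s, 0 ≤ s → ∀ t, 0 ≤ t → ∫ ω, g t ω * g s ω ∂μ ≤ C * Real.exp (-lam * |s - t|))
    {T : ℝ} (hT : 0 ≤ T) :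
    ∫ ω, (∫ t in (0:ℝ)..T, g t ω) ^ 2 ∂μ ≤ C * (2 / lam) * T := by
  set ν : Measure ℝ := volume.restrict (Set.Ioc 0 T) with hν
  have hsq : ∀ ω, (∫ t in (0:ℝ)..T, g t ω) ^ 2 = ∫ p, g p.1 ω * g p.2 ω ∂(ν.prod ν) := by
    intro ω
    rw [intervalIntegral.integral_of_le hT, sq,
      integral_prod_mul (μ := ν) (ν := ν) (fun t => g t ω) (fun t => g t ω)]
  have hmeas : Measurable fun q : Ω × (ℝ × ℝ) => g q.2.1 q.1 * g q.2.2 q.1 :=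
    (hg.comp (measurable_snd.fst.prodMk measurable_fst)).mul
      (hg.comp (measurable_snd.snd.prodMk measurable_fst))
  have hint : Integrable (fun q : Ω × (ℝ × ℝ) => g q.2.1 q.1 * g q.2.2 q.1)
      (μ.prod (ν.prod ν)) := by
    refine Integrable.of_bound hmeas.aestronglyMeasurable (B * B) (ae_of_all _ fun q => ?_)
    rw [Real.norm_eq_abs, abs_mul]
    exact mul_le_mul (hB _ _) (hB _ _) (abs_nonneg _) ((abs_nonneg _).trans (hB q.2.1 q.1))
  have hexp : Integrable (fun p : ℝ × ℝ => C * Real.exp (-lam * |p.2 - p.1|)) (ν.prod ν) := by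
    refine Integrable.of_bound (by fun_prop) C (ae_of_all _ fun p => ?_)
    rw [Real.norm_eq_abs, abs_of_nonneg (by positivity)]
    refine mul_le_of_le_one_right hC (Real.exp_le_one_iff.2 ?_)
    nlinarith [abs_nonneg (p.2 - p.1)]
  have hpos : ∀ᵐ p ∂(ν.prod ν), 0 ≤ p.1 ∧ 0 ≤ p.2 := by
    rw [hν, Measure.prod_restrict]
    filter_upwards [ae_restrict_mem (measurableSet_Ioc.prod measurableSet_Ioc)] with p hp
    exact ⟨hp.1.1.le, hp.2.1.le⟩
  have hinner : ∀ t, ∫ s, C * Real.exp (-lam * |s - t|) ∂ν ≤ C * (2 / lam) := by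
    intro t
    rw [integral_const_mul]
    refine mul_le_mul_of_nonneg_left ?_ hC
    calc ∫ s, Real.exp (-lam * |s - t|) ∂ν
        ≤ ∫ s, Real.exp (-lam * |s - t|) :=
          setIntegral_le_integral ((integrable_exp_neg_mul_abs hlam).comp_sub_right t)
            (ae_of_all _ fun s => (Real.exp_pos _).le)
      _ = 2 / lam := by
          rw [integral_sub_right_eq_self (fun s => Real.exp (-lam * |s|)) t,
            integral_exp_neg_mul_abs hlam]
  calc ∫ ω, (∫ t in (0:ℝ)..T, g t ω) ^ 2 ∂μ
      = ∫ p, ∫ ω, g p.1 ω * g p.2 ω ∂μ ∂(ν.prod ν) := by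
        simp_rw [hsq]
        exact integral_integral_swap hint
    _ ≤ ∫ p, C * Real.exp (-lam * |p.2 - p.1|) ∂(ν.prod ν) := by
        refine integral_mono_ae hint.integral_prod_right hexp ?_
        filter_upwards [hpos] with p hp
        exact hcorr _ hp.2 _ hp.1
    _ = ∫ t, ∫ s, C * Real.exp (-lam * |s - t|) ∂ν ∂ν := integral_prod _ hexp
    _ ≤ ∫ _, C * (2 / lam) ∂ν :=
        integral_mono hexp.integral_prod_left (integrable_const _) hinner
    _ = C * (2 / lam) * T := by
        simp [hν, hT, mul_comm]

theorem ae_tendsto_zero_of_integral_sq_le {Ω : Type*} [MeasurableSpace Ω] {μ : Measure Ω}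
    {X : ℕ → Ω → ℝ} (hX : ∀ n, Integrable (fun ω => X n ω ^ 2) μ) {a : ℕ → ℝ} (ha : Summable a)
    (hle : ∀ n, ∫ ω, X n ω ^ 2 ∂μ ≤ a n) :
    ∀ᵐ ω ∂μ, Tendsto (fun n => X n ω) atTop (𝓝 0) := by
  have hm : ∀ n, AEMeasurable (fun ω => ENNReal.ofReal (X n ω ^ 2)) μ :=
    fun n => (hX n).aemeasurable.ennreal_ofReal
  have hfin : ∫⁻ ω, ∑' n, ENNReal.ofReal (X n ω ^ 2) ∂μ ≠ ⊤ := by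
    rw [lintegral_tsum hm]
    refine ne_top_of_le_ne_top ha.tsum_ofReal_ne_top (ENNReal.tsum_le_tsum fun n => ?_)
    rw [← ofReal_integral_eq_lintegral_ofReal (hX n) (ae_of_all _ fun ω => sq_nonneg _)]
    exact ENNReal.ofReal_le_ofReal (hle n)
  filter_upwards [ae_lt_top' (AEMeasurable.tsum hm) hfin] with ω hω
  have h0 := ENNReal.tendsto_atTop_zero_of_tsum_ne_top hω.ne
  have h1 : Tendsto (fun n => X n ω ^ 2) atTop (𝓝 0) := by
    have := (ENNReal.tendsto_toReal ENNReal.zero_ne_top).comp h0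
    simpa [Function.comp_def, ENNReal.toReal_ofReal, sq_nonneg] using this
  have h2 := h1.sqrt
  simp only [Real.sqrt_sq_eq_abs, Real.sqrt_zero] at h2
  exact (tendsto_zero_iff_abs_tendsto_zero _).2 h2

/-- Time averages of a bounded function converge to zero as soon as they do along the squares. -/
theorem tendsto_average_of_tendsto_average_sq_s4 {h : ℝ → ℝ} (hm : Measurable h) {B : ℝ}
    (hB : ∀ t, |h t| ≤ B)
    (hlim : Tendsto (fun n : ℕ => ((n : ℝ) ^ 2)⁻¹ * ∫ t in (0:ℝ)..((n : ℝ) ^ 2), h t)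
      atTop (𝓝 0)) :
    Tendsto (fun T : ℝ => T⁻¹ * ∫ t in (0:ℝ)..T, h t) atTop (𝓝 0) := by
  have hB0 : 0 ≤ B := (abs_nonneg _).trans (hB 0)
  have hint : ∀ a b, IntervalIntegrable h volume a b := fun a b =>
    (intervalIntegrable_const (c := B)).mono_fun hm.aestronglyMeasurable
      (ae_of_all _ fun t => by simpa [abs_of_nonneg hB0] using hB t)
  have hgap : Tendsto (fun n : ℕ => B * (2 * (n : ℝ)⁻¹ + (n : ℝ)⁻¹ * (n : ℝ)⁻¹)) atTop (𝓝 0) := by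
    have hinv := tendsto_inv_atTop_nhds_zero_nat (𝕜 := ℝ)
    simpa using ((hinv.const_mul 2).add (hinv.mul hinv)).const_mul B
  have hfloor : Tendsto (fun T : ℝ => ⌊√T⌋₊) atTop atTop :=
    tendsto_nat_floor_atTop.comp Real.tendsto_sqrt_atTop
  have hbound := (hlim.abs.add hgap).comp hfloor
  rw [abs_zero, add_zero] at hbound
  refine squeeze_zero_norm' ?_ hbound
  filter_upwards [eventually_ge_atTop (1 : ℝ)] with T hT
  simp only [Function.comp_apply]
  set n := ⌊√T⌋₊
  have hsqrt : √T * √T = T := Real.mul_self_sqrt (by linarith)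
  have hn1 : (1 : ℝ) ≤ n := by
    exact_mod_cast Nat.le_floor (by simpa using Real.one_le_sqrt.2 hT)
  have hnle : (n : ℝ) ≤ √T := Nat.floor_le (Real.sqrt_nonneg T)
  have hlt : √T < n + 1 := Nat.lt_floor_add_one _
  have hle : (n : ℝ) ^ 2 ≤ T := by nlinarith
  have hub : T - (n : ℝ) ^ 2 ≤ 2 * n + 1 := by nlinarith [Real.sqrt_nonneg T]
  have hn2 : (0 : ℝ) < (n : ℝ) ^ 2 := by positivity
  have hdiff : |∫ t in ((n : ℝ) ^ 2)..T, h t| ≤ B * (2 * n + 1) := by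
    have := intervalIntegral.norm_integral_le_of_norm_le_const (a := (n : ℝ) ^ 2) (b := T)
      (f := h) (C := B) (fun t _ => hB t)
    rw [Real.norm_eq_abs, abs_of_nonneg (sub_nonneg.2 hle)] at this
    exact this.trans (mul_le_mul_of_nonneg_left hub hB0)
  rw [← intervalIntegral.integral_add_adjacent_intervals (hint 0 ((n : ℝ) ^ 2)) (hint _ T),
    Real.norm_eq_abs, abs_mul, abs_mul, abs_of_pos (inv_pos.2 (hn2.trans_le hle)),
    abs_of_pos (inv_pos.2 hn2)]
  calc T⁻¹ * |(∫ t in (0:ℝ)..((n : ℝ) ^ 2), h t) + ∫ t in ((n : ℝ) ^ 2)..T, h t|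
      ≤ ((n : ℝ) ^ 2)⁻¹ * (|∫ t in (0:ℝ)..((n : ℝ) ^ 2), h t| + B * (2 * n + 1)) := by
        gcongr
        exact (abs_add_le _ _).trans (by gcongr)
    _ = _ := by field_simp

/-- A strong law of large numbers for a continuous-time family
`(f_t)_{t ≥ 0}` of functions `f_t : [0,2π] → ℝ`, jointly measurable in `(t, θ)`, which are
uniformly bounded, have zero mean, exponentially decaying correlations, and are Lipschitz in `t`:
for Lebesgue-almost every `θ ∈ [0,2π]`, `(1/T) ∫₀^T f_t(θ) dt → 0` as `T → ∞`. -/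
theorem stmt4 (f : ℝ → ℝ → ℝ)
    (hmeas : Measurable fun p : {t : ℝ // 0 ≤ t} × ℝ => f p.1 p.2)
    (B : ℝ) (hB : 0 < B) (hbdd : ∀ t, 0 ≤ t → ∀ θ, |f t θ| ≤ B)
    (hmean : ∀ t, 0 ≤ t → (∫ θ in (0:ℝ)..(2 * π), f t θ) = 0)
    (C lam : ℝ) (hC : 0 < C) (hlam : 0 < lam)
    (hcorr : ∀ s, 0 ≤ s → ∀ t, 0 ≤ t →
      (∫ θ in (0:ℝ)..(2 * π), f t θ * f s θ) ≤ C * Real.exp (-lam * |s - t|))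
    (M : ℝ) (hM : 0 < M)
    (hlipt : ∀ s, 0 ≤ s → ∀ t, 0 ≤ t → ∀ θ, |f t θ - f s θ| ≤ 2 * M * |t - s|) :
    ∀ᵐ θ ∂(volume.restrict (Set.Icc (0:ℝ) (2 * π))),
      Tendsto (fun T : ℝ => T⁻¹ * ∫ t in (0:ℝ)..T, f t θ) atTop (𝓝 0) := by
  set g : ℝ → ℝ → ℝ := fun t θ => f (max t 0) θ with hgdef
  have hg : Measurable (Function.uncurry g) := by
    have hproj : Measurable fun p : ℝ × ℝ => ((⟨max p.1 0, le_max_right _ _⟩, p.2) :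
        {t : ℝ // 0 ≤ t} × ℝ) :=
      ((measurable_fst.max measurable_const).subtype_mk).prodMk measurable_snd
    exact hmeas.comp hproj
  have hgB : ∀ t θ, |g t θ| ≤ B := fun t θ => hbdd _ (le_max_right _ _) θ
  have hgf : ∀ t, 0 ≤ t → g t = f t := fun t ht => by simp [hgdef, ht]
  rw [← Measure.restrict_congr_set (Ioc_ae_eq_Icc (μ := volume))]
  set μ : Measure ℝ := volume.restrict (Set.Ioc 0 (2 * π)) with hμ
  have hgcorr : ∀ s, 0 ≤ s → ∀ t, 0 ≤ t →
      ∫ θ, g t θ * g s θ ∂μ ≤ C * Real.exp (-lam * |s - t|) := by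
    intro s hs t ht
    rw [hgf s hs, hgf t ht, hμ, ← intervalIntegral.integral_of_le (by positivity)]
    exact hcorr s hs t ht
  have hSmeas : ∀ T : ℝ, Measurable fun θ => ∫ t in (0:ℝ)..T, g t θ := by
    intro T
    have hswap : StronglyMeasurable (Function.uncurry fun θ t => g t θ) :=
      (hg.comp measurable_swap).stronglyMeasurable
    simp only [intervalIntegral]
    exact (hswap.integral_prod_right.sub hswap.integral_prod_right).measurable
  have hSbound : ∀ T θ, |∫ t in (0:ℝ)..T, g t θ| ≤ B * |T| := by
    intro T θ
    simpa using intervalIntegral.norm_integral_le_of_norm_le_const (a := 0) (b := T)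
      (f := fun t => g t θ) (C := B) (fun t _ => hgB t θ)
  have hsquares : ∀ᵐ θ ∂μ, Tendsto
      (fun n : ℕ => ((n : ℝ) ^ 2)⁻¹ * ∫ t in (0:ℝ)..((n : ℝ) ^ 2), g t θ) atTop (𝓝 0) := by
    refine ae_tendsto_zero_of_integral_sq_le (a := fun n => C * (2 / lam) * ((n : ℝ) ^ 2)⁻¹)
      (fun n => ?_) ((Real.summable_nat_pow_inv.2 one_lt_two).mul_left _) (fun n => ?_)
    · simp_rw [mul_pow]
      refine (Integrable.of_bound ((hSmeas _).pow_const 2).aestronglyMeasurable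
        ((B * |(n : ℝ) ^ 2|) ^ 2) (ae_of_all _ fun θ => ?_)).const_mul _
      rw [norm_pow, Real.norm_eq_abs]
      exact pow_le_pow_left₀ (abs_nonneg _) (hSbound _ θ) 2
    · simp_rw [mul_pow]
      rw [integral_const_mul]
      refine (mul_le_mul_of_nonneg_left (integral_sq_intervalIntegral_le hg hgB hC.le hlam hgcorr
        (sq_nonneg (n : ℝ))) (by positivity)).trans_eq ?_
      rcases eq_or_ne (n : ℝ) 0 with hn | hn
      · simp [hn]
      · field_simp
  filter_upwards [hsquares] with θ hθ
  refine (tendsto_average_of_tendsto_average_sq_s4 (hg.comp (measurable_id.prodMk measurable_const))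
    (fun t => hgB t θ) hθ).congr' ?_
  filter_upwards [eventually_ge_atTop (0 : ℝ)] with T hT
  congr 1
  refine intervalIntegral.integral_congr fun t ht => ?_
  rw [Set.uIcc_of_le hT] at ht
  exact congrFun (hgf t ht.1) θ
end

section
/- Let (Ω, ℱ, P) be a probability space, let 0 < ε < 1, and let (X_i)_{i ≥ 1} be random variables with values in {0, 1} such that for every finite subset S ⊆ ℕ, P(X_i = 1 for all i ∈ S) ≤ ε^{|S|}. Then P-almost surely, limsup_{n → ∞} (1/n) ∑_{i=1}^n X_i ≤ 3ε. -/
open MeasureTheory Filter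

/-- If the joint occurrence probabilities of `{0, 1}`-valued random variables are at most those of
independent Bernoulli variables of parameter `ε`, then so is the expectation of `∏ (1 + X i)`. -/
lemma lintegral_prod_one_add_le {Ω : Type*} [MeasurableSpace Ω] (P : Measure Ω)
    {ε : ℝ} (hε : 0 ≤ ε) (X : ℕ → Ω → ℝ) (s : Finset ℕ)
    (hXmeas : ∀ i ∈ s, Measurable (X i)) (hX01 : ∀ i ∈ s, ∀ ω, X i ω = 0 ∨ X i ω = 1)
    (hcorr : ∀ T ⊆ s, P {ω | ∀ i ∈ T, X i ω = 1} ≤ ENNReal.ofReal (ε ^ T.card)) :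
    ∫⁻ ω, ENNReal.ofReal (∏ i ∈ s, (1 + X i ω)) ∂P ≤ ENNReal.ofReal ((1 + ε) ^ s.card) := by
  have hmeas : ∀ T ⊆ s, MeasurableSet {ω | ∀ i ∈ T, X i ω = 1} := fun T hT => by
    have h : {ω | ∀ i ∈ T, X i ω = 1} = ⋂ i ∈ T, X i ⁻¹' {1} := by ext; simp
    rw [h]
    exact T.measurableSet_biInter fun i hi => hXmeas i (hT hi) (measurableSet_singleton 1)
  have hexpand : ∀ ω, ENNReal.ofReal (∏ i ∈ s, (1 + X i ω)) =
      ∑ T ∈ s.powerset, {ω | ∀ i ∈ T, X i ω = 1}.indicator 1 ω := fun ω => by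
    have h0 : ∀ i ∈ s, 0 ≤ X i ω := fun i hi => by rcases hX01 i hi ω with h | h <;> simp [h]
    rw [Finset.prod_one_add, ENNReal.ofReal_sum_of_nonneg fun T hT =>
      Finset.prod_nonneg fun i hi => h0 i (Finset.mem_powerset.1 hT hi)]
    refine Finset.sum_congr rfl fun T hT => ?_
    by_cases h : ∀ i ∈ T, X i ω = 1
    · rw [Set.indicator_of_mem (by exact h), Finset.prod_congr rfl h]
      simp
    · rw [Set.indicator_of_notMem (by exact h)]
      push Not at h
      obtain ⟨i, hi, hne⟩ := h
      rw [Finset.prod_eq_zero hi ((hX01 i (Finset.mem_powerset.1 hT hi) ω).resolve_right hne),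
        ENNReal.ofReal_zero]
  have hsum : (1 + ε) ^ s.card = ∑ T ∈ s.powerset, ε ^ T.card := by
    have h := Finset.prod_one_add (f := fun _ => ε) s
    simpa using h
  simp_rw [hexpand]
  rw [lintegral_finsetSum' _ fun T hT =>
      (measurable_one.indicator (hmeas T (Finset.mem_powerset.1 hT))).aemeasurable,
    hsum, ENNReal.ofReal_sum_of_nonneg fun T _ => pow_nonneg hε _]
  refine Finset.sum_le_sum fun T hT => ?_
  rw [lintegral_indicator_one (hmeas T (Finset.mem_powerset.1 hT))]
  exact hcorr T (Finset.mem_powerset.1 hT)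

/-- Exponential tail bound for sums of `{0, 1}`-valued random variables whose joint occurrence
probabilities are at most those of independent Bernoulli variables of parameter `ε`. -/
lemma measure_three_mul_card_le_sum_le {Ω : Type*} [MeasurableSpace Ω] (P : Measure Ω)
    {ε : ℝ} (hε : 0 ≤ ε) (X : ℕ → Ω → ℝ) (s : Finset ℕ)
    (hXmeas : ∀ i ∈ s, Measurable (X i)) (hX01 : ∀ i ∈ s, ∀ ω, X i ω = 0 ∨ X i ω = 1)
    (hcorr : ∀ T ⊆ s, P {ω | ∀ i ∈ T, X i ω = 1} ≤ ENNReal.ofReal (ε ^ T.card)) :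
    P {ω | 3 * ε * s.card ≤ ∑ i ∈ s, X i ω} ≤ ENNReal.ofReal (Real.exp (-ε) ^ s.card) := by
  set c : ℝ := Real.exp (2 * ε * s.card) with hc
  have hsub : {ω | 3 * ε * s.card ≤ ∑ i ∈ s, X i ω} ⊆
      {ω | ENNReal.ofReal c ≤ ENNReal.ofReal (∏ i ∈ s, (1 + X i ω))} := fun ω hω => by
    have hω : 3 * ε * s.card ≤ ∑ i ∈ s, X i ω := hω
    have hprod : ∏ i ∈ s, (1 + X i ω) = Real.exp (Real.log 2 * ∑ i ∈ s, X i ω) := by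
      rw [Finset.mul_sum, Real.exp_sum]
      refine Finset.prod_congr rfl fun i hi => ?_
      rcases hX01 i hi ω with h | h <;> simp [h, Real.exp_log]
      norm_num
    refine ENNReal.ofReal_le_ofReal ?_
    rw [hprod, hc, Real.exp_le_exp]
    have hcard : 0 ≤ ε * s.card := by positivity
    nlinarith [Real.log_two_gt_d9]
  have hmeas : AEMeasurable (fun ω => ENNReal.ofReal (∏ i ∈ s, (1 + X i ω))) P :=
    (Finset.measurable_fun_prod s fun i hi =>
      (hXmeas i hi).const_add 1).ennreal_ofReal.aemeasurable
  have hc0 : 0 < c := Real.exp_pos _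
  calc P {ω | 3 * ε * s.card ≤ ∑ i ∈ s, X i ω}
      ≤ (∫⁻ ω, ENNReal.ofReal (∏ i ∈ s, (1 + X i ω)) ∂P) / ENNReal.ofReal c :=
        (measure_mono hsub).trans
          (meas_ge_le_lintegral_div hmeas (by simpa using hc0) ENNReal.ofReal_ne_top)
    _ ≤ ENNReal.ofReal ((1 + ε) ^ s.card) / ENNReal.ofReal c :=
        ENNReal.div_le_div_right (lintegral_prod_one_add_le P hε X s hXmeas hX01 hcorr) _
    _ ≤ ENNReal.ofReal (Real.exp (-ε) ^ s.card) := by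
        rw [← ENNReal.ofReal_div_of_pos hc0]
        refine ENNReal.ofReal_le_ofReal ?_
        have h : Real.exp (-ε) ^ s.card * c = Real.exp ε ^ s.card := by
          rw [hc, ← Real.exp_nat_mul, ← Real.exp_nat_mul, ← Real.exp_add]
          ring_nf
        rw [div_le_iff₀ hc0, h]
        gcongr
        linarith [Real.add_one_le_exp ε]

open MeasureTheory Filter

/-- Let `(Ω, ℱ, P)` be a probability space, `0 < ε < 1`, and `(X_i)_{i ≥ 1}`
random variables with values in `{0, 1}` such that for every finite set `S` of indices `i ≥ 1`,
`P(X_i = 1 for all i ∈ S) ≤ ε^{|S|}`.  Then `P`-almost surely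
`limsup_{n→∞} (1/n) ∑_{i=1}^n X_i ≤ 3ε`. -/
theorem stmt6 {Ω : Type*} [MeasurableSpace Ω] (P : Measure Ω) [IsProbabilityMeasure P]
    (ε : ℝ) (hε₀ : 0 < ε) (hε₁ : ε < 1)
    (X : ℕ → Ω → ℝ) (hXmeas : ∀ i, 1 ≤ i → Measurable (X i))
    (hX01 : ∀ i, 1 ≤ i → ∀ ω, X i ω = 0 ∨ X i ω = 1)
    (hcorr : ∀ S : Finset ℕ, (∀ i ∈ S, 1 ≤ i) →
      P {ω | ∀ i ∈ S, X i ω = 1} ≤ ENNReal.ofReal (ε ^ S.card)) :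
    ∀ᵐ ω ∂P,
      limsup (fun n : ℕ => (n : ℝ)⁻¹ * ∑ i ∈ Finset.Icc 1 n, X i ω) atTop ≤ 3 * ε := by
  have htail (n : ℕ) : P {ω | 3 * ε * n ≤ ∑ i ∈ Finset.Icc 1 n, X i ω} ≤
      ENNReal.ofReal (Real.exp (-ε) ^ n) := by
    have hmem : ∀ i ∈ Finset.Icc 1 n, 1 ≤ i := fun i hi => (Finset.mem_Icc.1 hi).1
    simpa using measure_three_mul_card_le_sum_le P hε₀.le X (Finset.Icc 1 n)
      (fun i hi => hXmeas i (hmem i hi)) (fun i hi => hX01 i (hmem i hi))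
      (fun T hT => hcorr T fun i hi => hmem i (hT hi))
  have hsummable : Summable fun n : ℕ => Real.exp (-ε) ^ n :=
    summable_geometric_of_lt_one (Real.exp_pos _).le (Real.exp_lt_one_iff.2 (by linarith))
  have hfin : ∑' n : ℕ, P {ω | 3 * ε * n ≤ ∑ i ∈ Finset.Icc 1 n, X i ω} ≠ ⊤ :=
    ne_top_of_le_ne_top hsummable.tsum_ofReal_ne_top (ENNReal.tsum_le_tsum htail)
  filter_upwards [ae_eventually_notMem hfin] with ω hω
  have hnonneg (n : ℕ) : 0 ≤ (n : ℝ)⁻¹ * ∑ i ∈ Finset.Icc 1 n, X i ω := by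
    refine mul_nonneg (by positivity) (Finset.sum_nonneg fun i hi => ?_)
    rcases hX01 i (Finset.mem_Icc.1 hi).1 ω with h | h <;> simp [h]
  refine limsup_le_of_le (isCoboundedUnder_le_of_le atTop hnonneg) ?_
  filter_upwards [hω, eventually_gt_atTop 0] with n hn hpos
  have hn : ∑ i ∈ Finset.Icc 1 n, X i ω < 3 * ε * n := not_le.1 hn
  have hpos : (0 : ℝ) < n := by exact_mod_cast hpos
  rw [inv_mul_le_iff₀ hpos]
  linarith
end

section
/- Let V be a finite-dimensional real inner product space, let k be an integer with 1 ≤ k < dim V, and let Gr_k(V) denote the Grassmannian of k-dimensional subspaces of V and ℙ(V) the projective space of lines in V with a fixed metric d. Let (X, ν) and (Ω, P) be probability spaces, and let W: X × Ω → Gr_k(V) be a measurable map such that for ν-almost every y ∈ X and every line w ∈ ℙ(V), P({ω ∈ Ω : w ⊆ W(y, ω)}) = 0. Then for every δ > 0 and every ε > 0 there exist a measurable set E ⊆ X with ν(E) > 1 − δ and a constant σ > 0 such that for every y ∈ E and every line w ∈ ℙ(V), P({ω ∈ Ω : d(w, W(y, ω)) > σ}) > 1 − ε. -/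
open MeasureTheory

/-- A compact family of almost surely positive random variables which is `1`-Lipschitz in the
parameter is bounded below by a uniform positive constant with probability close to one. -/
theorem exists_forall_lt_measure_of_ae_pos {K Ω : Type*} [PseudoMetricSpace K] [CompactSpace K]
    [MeasurableSpace Ω] (P : Measure Ω) [IsProbabilityMeasure P] (f : Ω → K → ℝ)
    (hf : ∀ ω, LipschitzWith 1 (f ω)) (hpos : ∀ w, ∀ᵐ ω ∂P, 0 < f ω w)
    {c : ENNReal} (hc : c < 1) :
    ∃ σ > (0 : ℝ), ∀ w, c < P {ω | σ < f ω w} := by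
  suffices h : ∃ σ > (0 : ℝ), ∀ w ∈ (Set.univ : Set K), c < P {ω | σ < f ω w} by simpa using h
  refine isCompact_univ.induction_on (p := fun s ↦ ∃ σ > (0 : ℝ), ∀ w ∈ s, c < P {ω | σ < f ω w})
    ⟨1, one_pos, by simp⟩ ?_ ?_ ?_
  · rintro s t hst ⟨σ, hσ, h⟩
    exact ⟨σ, hσ, fun w hw ↦ h w (hst hw)⟩
  · rintro s t ⟨σ, hσ, h⟩ ⟨τ, hτ, h'⟩
    refine ⟨min σ τ, lt_min hσ hτ, ?_⟩
    rintro w (hw | hw)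
    · exact (h w hw).trans_le (measure_mono <|
        Set.ofPred_subset_ofPred.2 fun ω hω ↦ (min_le_left _ _).trans_lt hω)
    · exact (h' w hw).trans_le (measure_mono <|
        Set.ofPred_subset_ofPred.2 fun ω hω ↦ (min_le_right _ _).trans_lt hω)
  · intro w _
    have hmono : Monotone fun n : ℕ ↦ {ω | 1 / ((n : ℝ) + 1) < f ω w} := fun m n hmn ↦
      Set.ofPred_subset_ofPred.2 fun ω hω ↦ (Nat.one_div_le_one_div hmn).trans_lt hω
    have hunion : P (⋃ n : ℕ, {ω | 1 / ((n : ℝ) + 1) < f ω w}) = 1 := by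
      rw [← measure_univ (μ := P)]
      refine measure_congr (Filter.eventuallyEq_univ.2 ?_)
      filter_upwards [hpos w] with ω hω
      exact Set.mem_iUnion.2 (exists_nat_one_div_lt hω)
    obtain ⟨n, hn⟩ : ∃ n : ℕ, c < P {ω | 1 / ((n : ℝ) + 1) < f ω w} := by
      rwa [← hunion, hmono.measure_iUnion, lt_iSup_iff] at hc
    have hσ : (0 : ℝ) < 1 / ((n : ℝ) + 1) := Nat.one_div_pos_of_nat
    refine ⟨Metric.ball w (1 / ((n : ℝ) + 1) / 2),
      mem_nhdsWithin_of_mem_nhds (Metric.ball_mem_nhds w (half_pos hσ)), _, half_pos hσ, ?_⟩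
    intro v hv
    refine hn.trans_le (measure_mono fun ω hω ↦ ?_)
    have hlip := (hf ω).dist_le_mul v w
    rw [Metric.mem_ball] at hv
    rw [Real.dist_eq, NNReal.coe_one, one_mul, abs_le] at hlip
    simp only [Set.mem_ofPred_eq] at hω ⊢
    linarith

/-- A version of `exists_forall_lt_measure_of_ae_pos` that is uniform outside a set of small
measure of an additional measurable parameter. -/
theorem exists_measurableSet_forall_lt_measure_of_ae_pos {K X Ω : Type*} [PseudoMetricSpace K]
    [CompactSpace K] [MeasurableSpace X] [MeasurableSpace Ω]
    (ν : Measure X) [IsProbabilityMeasure ν] (P : Measure Ω) [IsProbabilityMeasure P]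
    (f : X × Ω → K → ℝ) (hf : ∀ p, LipschitzWith 1 (f p))
    (hmeas : ∀ w, Measurable fun p ↦ f p w)
    (hpos : ∀ᵐ y ∂ν, ∀ w, ∀ᵐ ω ∂P, 0 < f (y, ω) w)
    {b c : ENNReal} (hb : b < 1) (hc : c < 1) :
    ∃ E : Set X, MeasurableSet E ∧ b < ν E ∧
      ∃ σ > (0 : ℝ), ∀ y ∈ E, ∀ w, c < P {ω | σ < f (y, ω) w} := by
  obtain ⟨c', hcc', hc'⟩ := exists_between hc
  obtain ⟨D, hDc, hDd⟩ := TopologicalSpace.exists_countable_dense K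
  let E : ℕ → Set X := fun n ↦ ⋂ w ∈ D, {y | c' ≤ P {ω | 1 / ((n : ℝ) + 1) < f (y, ω) w}}
  have hEmeas (n : ℕ) : MeasurableSet (E n) := by
    refine .biInter hDc fun w _ ↦ measurableSet_le measurable_const ?_
    exact measurable_measure_prodMk_left (measurableSet_lt measurable_const (hmeas w))
  have hmono : Monotone E := fun m n hmn ↦ Set.iInter₂_mono fun w _ ↦
    Set.ofPred_subset_ofPred.2 fun y hy ↦ le_trans hy <| measure_mono <|
      Set.ofPred_subset_ofPred.2 fun ω hω ↦ (Nat.one_div_le_one_div hmn).trans_lt hω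
  have hunion : ν (⋃ n, E n) = 1 := by
    rw [← measure_univ (μ := ν)]
    refine measure_congr (Filter.eventuallyEq_univ.2 ?_)
    filter_upwards [hpos] with y hy
    obtain ⟨σ, hσ, h⟩ :=
      exists_forall_lt_measure_of_ae_pos P (fun ω ↦ f (y, ω)) (fun ω ↦ hf (y, ω)) hy hc'
    obtain ⟨n, hn⟩ := exists_nat_one_div_lt hσ
    exact Set.mem_iUnion.2 ⟨n, Set.mem_iInter₂.2 fun w _ ↦
      (h w).le.trans (measure_mono fun ω hω ↦ hn.trans hω)⟩
  obtain ⟨n, hn⟩ : ∃ n, b < ν (E n) := by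
    rwa [← hunion, hmono.measure_iUnion, lt_iSup_iff] at hb
  have hσ : (0 : ℝ) < 1 / ((n : ℝ) + 1) := Nat.one_div_pos_of_nat
  refine ⟨E n, hEmeas n, hn, _, half_pos hσ, fun y hy w ↦ ?_⟩
  obtain ⟨v, hvD, hv⟩ := hDd.exists_dist_lt w (half_pos hσ)
  refine (hcc'.trans_le (Set.mem_iInter₂.1 hy v hvD)).trans_le (measure_mono fun ω hω ↦ ?_)
  have hlip := (hf (y, ω)).dist_le_mul w v
  rw [Real.dist_eq, NNReal.coe_one, one_mul, abs_le] at hlip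
  simp only [Set.mem_ofPred_eq] at hω ⊢
  linarith

/-- A vector outside a nontrivial subspace has positive distance to the unit sphere of it. -/
theorem Submodule.infDist_unitSphere_pos_of_notMem {V : Type*} [NormedAddCommGroup V]
    [InnerProductSpace ℝ V] [FiniteDimensional ℝ V] {S : Submodule ℝ V}
    (hS : S ≠ ⊥) {w : V} (hw : w ∉ S) :
    0 < Metric.infDist w {u : V | u ∈ S ∧ ‖u‖ = 1} := by
  have hclosed : IsClosed {u : V | u ∈ S ∧ ‖u‖ = 1} :=
    S.closed_of_finiteDimensional.inter (isClosed_eq continuous_norm continuous_const)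
  have hne : {u : V | u ∈ S ∧ ‖u‖ = 1}.Nonempty := by
    obtain ⟨x, hx, hx0⟩ := S.exists_mem_ne_zero_of_ne_bot hS
    exact ⟨‖x‖⁻¹ • x, S.smul_mem _ hx, norm_smul_inv_norm (𝕜 := ℝ) hx0⟩
  exact (hclosed.notMem_iff_infDist_pos hne).1 fun h ↦ hw h.1

/-- Let `V` be a finite-dimensional real inner product space and `1 ≤ k < dim V`.
Lines in `V` (points of `ℙ(V)`) are represented by unit vectors `w` (note `w` and `-w` represent
the same line), a line `w` is contained in a subspace `W'` iff `w ∈ W'`, and the distance from the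
line `w` to the set of lines contained in `W'` is realized as the distance from `w` to the
(symmetric) set of unit vectors of `W'`.  Let `(X, ν)`, `(Ω, P)` be probability spaces and
`W : X × Ω → Gr_k(V)` a measurable map such that for `ν`-a.e. `y` and every line `w`,
`P({ω : w ⊆ W(y,ω)}) = 0`.  Then for all `δ, ε > 0` there are a measurable `E ⊆ X` with
`ν(E) > 1 − δ` and `σ > 0` such that for every `y ∈ E` and every line `w`,
`P({ω : d(w, W(y,ω)) > σ}) > 1 − ε`. -/
theorem stmt8 {V : Type*} [NormedAddCommGroup V] [InnerProductSpace ℝ V]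
    [FiniteDimensional ℝ V]
    (k : ℕ) (hk₁ : 1 ≤ k) (hk₂ : k < Module.finrank ℝ V)
    {X Ω : Type*} [MeasurableSpace X] [MeasurableSpace Ω]
    (ν : Measure X) [IsProbabilityMeasure ν] (P : Measure Ω) [IsProbabilityMeasure P]
    (W : X × Ω → Submodule ℝ V)
    (hWrank : ∀ p, Module.finrank ℝ (W p) = k)
    (hWmeas : ∀ w : V, Measurable fun p : X × Ω =>
      Metric.infDist w {u : V | u ∈ W p ∧ ‖u‖ = 1})
    (hnull : ∀ᵐ y ∂ν, ∀ w : V, ‖w‖ = 1 → P {ω | w ∈ W (y, ω)} = 0)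
    (δ ε : ℝ) (hδ : 0 < δ) (hε : 0 < ε) :
    ∃ E : Set X, MeasurableSet E ∧ 1 - ENNReal.ofReal δ < ν E ∧
      ∃ σ > (0:ℝ), ∀ y ∈ E, ∀ w : V, ‖w‖ = 1 →
        1 - ENNReal.ofReal ε <
          P {ω | σ < Metric.infDist w {u : V | u ∈ W (y, ω) ∧ ‖u‖ = 1}} := by
  obtain ⟨E, hE, hνE, σ, hσ, h⟩ := exists_measurableSet_forall_lt_measure_of_ae_pos
    (K := Metric.sphere (0 : V) 1) ν P
    (fun p w ↦ Metric.infDist (w : V) {u : V | u ∈ W p ∧ ‖u‖ = 1})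
    (fun p ↦ by
      rw [← one_mul (1 : NNReal)]
      exact (Metric.lipschitz_infDist_pt _).comp (LipschitzWith.subtype_val _))
    (fun w ↦ hWmeas w)
    (by
      filter_upwards [hnull] with y hy w
      have hw : ∀ᵐ ω ∂P, (w : V) ∉ W (y, ω) := by
        simpa [ae_iff] using hy w (mem_sphere_zero_iff_norm.1 w.2)
      filter_upwards [hw] with ω hω
      refine Submodule.infDist_unitSphere_pos_of_notMem (fun hbot ↦ ?_) hω
      have hrank := hWrank (y, ω)
      rw [hbot, finrank_bot] at hrank
      omega)
    (ENNReal.sub_lt_self ENNReal.one_ne_top one_ne_zero (ENNReal.ofReal_pos.2 hδ).ne')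
    (ENNReal.sub_lt_self ENNReal.one_ne_top one_ne_zero (ENNReal.ofReal_pos.2 hε).ne')
  exact ⟨E, hE, hνE, σ, hσ, fun y hy w hw ↦ h y hy ⟨w, mem_sphere_zero_iff_norm.2 hw⟩⟩
end

section
/- Let C ≥ 1, let L ≥ 1 be an integer, let λ > 0 and 0 < ε < λ, and let (a_n)_{n ≥ 0} be positive real numbers with a₀ = 1 and C^{−1} ≤ a_n / a_{n−1} ≤ C for all n ≥ 1. Suppose I ⊆ ℕ is a set of indices such that the intervals {i+1, …, i+L} for i ∈ I are pairwise disjoint and their union has lower natural density at least 1 − 4ε in ℕ. Then: (i) if a_{i+L} / a_i ≥ e^{(λ−ε)L} for every i ∈ I, then liminf_{n → ∞} (1/n) log a_n ≥ (1 − 4ε)(λ − ε) − 4ε log C; and (ii) if a_{i+L} / a_i ≤ e^{(λ+ε)L} for every i ∈ I, then limsup_{n → ∞} (1/n) log a_n ≤ (λ + ε) + 4ε log C. -/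
open Filter

/-- The lower natural density of a set `S ⊆ ℕ`: `liminf_{n→∞} |S ∩ [1,n]| / n`. -/
noncomputable def lowerDensity (S : Set ℕ) : ℝ :=
  liminf (fun n : ℕ => ((S ∩ Set.Icc 1 n).ncard : ℝ) / n) atTop

theorem ncard_inter_Icc_succ_of_notMem {S : Set ℕ} {n : ℕ} (h : n + 1 ∉ S) :
    (S ∩ Set.Icc 1 (n + 1)).ncard = (S ∩ Set.Icc 1 n).ncard := by
  congr 1
  ext k
  simp only [Set.mem_inter_iff, Set.mem_Icc]
  refine ⟨fun ⟨hk, h1, h2⟩ => ⟨hk, h1, ?_⟩, fun ⟨hk, h1, h2⟩ => ⟨hk, h1, by omega⟩⟩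
  have : k ≠ n + 1 := fun e => h (e ▸ hk)
  omega

theorem ncard_inter_Icc_add_le (S : Set ℕ) (m k : ℕ) :
    (S ∩ Set.Icc 1 (m + k)).ncard ≤ (S ∩ Set.Icc 1 m).ncard + k := by
  have hsub : S ∩ Set.Icc 1 (m + k) ⊆ (S ∩ Set.Icc 1 m) ∪ Set.Ioc m (m + k) := by
    rintro x ⟨hx, h1, h2⟩
    rcases le_or_gt x m with h | h
    · exact Or.inl ⟨hx, h1, h⟩
    · exact Or.inr ⟨h, h2⟩
  have hfin : ((S ∩ Set.Icc 1 m) ∪ Set.Ioc m (m + k)).Finite :=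
    ((Set.finite_Icc 1 m).inter_of_right S).union (Set.finite_Ioc m (m + k))
  have hcard : (Set.Ioc m (m + k)).ncard = k := by
    rw [← Finset.coe_Ioc, Set.ncard_coe_finset, Nat.card_Ioc, Nat.add_sub_cancel_left]
  calc (S ∩ Set.Icc 1 (m + k)).ncard
      ≤ ((S ∩ Set.Icc 1 m) ∪ Set.Ioc m (m + k)).ncard := Set.ncard_le_ncard hsub hfin
    _ ≤ (S ∩ Set.Icc 1 m).ncard + (Set.Ioc m (m + k)).ncard := Set.ncard_union_le _ _
    _ = _ := by rw [hcard]

theorem ncard_inter_Icc_zero (S : Set ℕ) : (S ∩ Set.Icc 1 0).ncard = 0 := by simp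

theorem ncard_inter_Icc_le (S : Set ℕ) (n : ℕ) : (S ∩ Set.Icc 1 n).ncard ≤ n := by
  simpa [ncard_inter_Icc_zero] using ncard_inter_Icc_add_le S 0 n

/-- A monotone sequence starting at `0` which grows by at least `ν * L` across each of the disjoint
blocks `(i, i + L]` grows on average by at least `ν` per covered index. -/
theorem mul_ncard_blocks_le {y : ℕ → ℝ} (hy : Monotone y) (hy₀ : y 0 = 0) {L : ℕ} (hL : 1 ≤ L)
    {ν : ℝ} {I : Set ℕ}
    (hdisj : I.Pairwise fun i j => Disjoint (Set.Ioc i (i + L)) (Set.Ioc j (j + L)))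
    (hblock : ∀ i ∈ I, ν * L ≤ y (i + L) - y i) (n : ℕ) :
    ν * (((⋃ i ∈ I, Set.Ioc i (i + L)) ∩ Set.Icc 1 n).ncard : ℝ) - L * |ν| ≤ y n := by
  set S : Set ℕ := ⋃ i ∈ I, Set.Ioc i (i + L) with hS
  have hmem (k : ℕ) : k ∈ S ↔ ∃ i ∈ I, i < k ∧ k ≤ i + L := by
    simp only [hS, Set.mem_iUnion, Set.mem_Ioc, exists_prop]
  have hLν : 0 ≤ L * |ν| := by positivity
  rcases le_or_gt ν 0 with hν | hν
  · have h1 : ν * ((S ∩ Set.Icc 1 n).ncard : ℝ) ≤ 0 :=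
      mul_nonpos_of_nonpos_of_nonneg hν (Nat.cast_nonneg _)
    have h2 : y 0 ≤ y n := hy (Nat.zero_le n)
    linarith
  have hadd (m k : ℕ) : ν * ((S ∩ Set.Icc 1 (m + k)).ncard : ℝ) ≤
      ν * ((S ∩ Set.Icc 1 m).ncard : ℝ) + ν * k := by
    rw [← mul_add]
    exact mul_le_mul_of_nonneg_left (mod_cast ncard_inter_Icc_add_le S m k) hν.le
  have hstart {i j : ℕ} (hi : i ∈ I) (hj : j ∈ I) : ¬ (j < i ∧ i < j + L) := by
    rintro ⟨h1, h2⟩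
    have h3 : i + 1 ∈ Set.Ioc i (i + L) := ⟨by omega, by omega⟩
    have h4 : i + 1 ∈ Set.Ioc j (j + L) := ⟨by omega, by omega⟩
    exact Set.disjoint_left.1 (hdisj hi hj h1.ne') h3 h4
  have key (m : ℕ) (hm : ∀ i ∈ I, ¬ (i < m ∧ m < i + L)) :
      ν * ((S ∩ Set.Icc 1 m).ncard : ℝ) ≤ y m := by
    induction m using Nat.strong_induction_on with
    | _ m ih =>
      rcases m with _ | m
      · simp [hy₀]
      by_cases hmS : m + 1 ∈ S
      · obtain ⟨i, hi, h1, h2⟩ := (hmem _).1 hmS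
        have hend : m + 1 = i + L := by have := hm i hi; omega
        have hi' := ih i h1 fun j hj => hstart hi hj
        rw [hend]
        linarith [hadd i L, hblock i hi]
      · have hm' := ih m (Nat.lt_succ_self m) fun i hi h =>
          hmS ((hmem _).2 ⟨i, hi, by omega, by omega⟩)
        rw [ncard_inter_Icc_succ_of_notMem hmS]
        exact hm'.trans (hy (Nat.le_succ m))
  by_cases hn : ∀ i ∈ I, ¬ (i < n ∧ n < i + L)
  · linarith [key n hn]
  · push Not at hn
    obtain ⟨i, hi, h1, h2⟩ := hn
    have h3 := key i fun j hj => hstart hi hj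
    have h4 := hadd i (n - i)
    rw [Nat.add_sub_cancel' h1.le] at h4
    have h5 : ν * ((n - i : ℕ) : ℝ) ≤ ν * L :=
      mul_le_mul_of_nonneg_left (mod_cast (by omega : n - i ≤ L)) hν.le
    rw [abs_of_pos hν]
    linarith [hy h1.le, mul_comm ν (L : ℝ)]

theorem eventually_lt_ncard_div_of_lt_lowerDensity {S : Set ℕ} {r : ℝ} (h : r < lowerDensity S) :
    ∀ᶠ n : ℕ in atTop, r < ((S ∩ Set.Icc 1 n).ncard : ℝ) / n :=
  eventually_lt_of_lt_liminf h
    (isBoundedUnder_of_eventually_ge (Eventually.of_forall fun n => by positivity) (a := 0))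

/-- **telescoping estimate.** Let `C ≥ 1`, `L ≥ 1`, `λ > 0`, `0 < ε < λ`, and let
`(a_n)` be positive reals with `a₀ = 1` and `C⁻¹ ≤ aₙ/aₙ₋₁ ≤ C`.  Let `I ⊆ ℕ` be a set of indices
whose blocks `{i+1, …, i+L}` are pairwise disjoint with union of lower natural density at least
`1 − 4ε`.  Then: (i) if `a_{i+L}/a_i ≥ e^{(λ−ε)L}` for all `i ∈ I` then
`liminf (1/n) log aₙ ≥ (1−4ε)(λ−ε) − 4ε log C`; and (ii) if `a_{i+L}/a_i ≤ e^{(λ+ε)L}` for all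
`i ∈ I` then `limsup (1/n) log aₙ ≤ (λ+ε) + 4ε log C`. -/
theorem stmt10 (C : ℝ) (hC : 1 ≤ C) (L : ℕ) (hL : 1 ≤ L)
    (lam ε : ℝ) (hlam : 0 < lam) (hε₀ : 0 < ε) (hεlam : ε < lam)
    (a : ℕ → ℝ) (ha₀ : a 0 = 1) (hapos : ∀ n, 0 < a n)
    (hratio : ∀ n, 1 ≤ n → C⁻¹ ≤ a n / a (n - 1) ∧ a n / a (n - 1) ≤ C)
    (I : Set ℕ)
    (hdisj : I.Pairwise fun i j => Disjoint (Set.Ioc i (i + L)) (Set.Ioc j (j + L)))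
    (hdens : 1 - 4 * ε ≤ lowerDensity (⋃ i ∈ I, Set.Ioc i (i + L))) :
    ((∀ i ∈ I, Real.exp ((lam - ε) * L) ≤ a (i + L) / a i) →
      (1 - 4 * ε) * (lam - ε) - 4 * ε * Real.log C ≤
        liminf (fun n : ℕ => Real.log (a n) / n) atTop) ∧
    ((∀ i ∈ I, a (i + L) / a i ≤ Real.exp ((lam + ε) * L)) →
      limsup (fun n : ℕ => Real.log (a n) / n) atTop ≤ (lam + ε) + 4 * ε * Real.log C) := by
  set S : Set ℕ := ⋃ i ∈ I, Set.Ioc i (i + L) with hS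
  set c := Real.log C with hc
  have hc₀ : 0 ≤ c := Real.log_nonneg hC
  have hC₀ : 0 < C := by linarith
  have hstep (n : ℕ) : -c ≤ Real.log (a (n + 1)) - Real.log (a n) ∧
      Real.log (a (n + 1)) - Real.log (a n) ≤ c := by
    obtain ⟨h1, h2⟩ := hratio (n + 1) (by omega)
    rw [Nat.add_sub_cancel] at h1 h2
    rw [← Real.log_div (hapos _).ne' (hapos _).ne', hc, ← Real.log_inv]
    exact ⟨Real.log_le_log (inv_pos.2 hC₀) h1,
      Real.log_le_log (div_pos (hapos _) (hapos _)) h2⟩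
  have hmono₁ : Monotone fun n : ℕ => Real.log (a n) + c * n :=
    monotone_nat_of_le_succ fun n => by push_cast; linarith [(hstep n).1]
  have hmono₂ : Monotone fun n : ℕ => c * n - Real.log (a n) :=
    monotone_nat_of_le_succ fun n => by push_cast; linarith [(hstep n).2]
  have hlower : ∀ᶠ n : ℕ in atTop, -c ≤ Real.log (a n) / n := by
    filter_upwards [eventually_gt_atTop 0] with n hn
    rw [le_div_iff₀ (mod_cast hn)]
    have := hmono₁ (Nat.zero_le n)
    simp only [ha₀, Real.log_one, Nat.cast_zero, mul_zero, add_zero] at this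
    linarith
  have hupper : ∀ᶠ n : ℕ in atTop, Real.log (a n) / n ≤ c := by
    filter_upwards [eventually_gt_atTop 0] with n hn
    rw [div_le_iff₀ (mod_cast hn)]
    have := hmono₂ (Nat.zero_le n)
    simp only [ha₀, Real.log_one, Nat.cast_zero, mul_zero, sub_zero] at this
    linarith
  have hboundary (K η : ℝ) (hη : 0 < η) : ∀ᶠ n : ℕ in atTop, K / n < η :=
    (tendsto_const_div_atTop_nhds_zero_nat K).eventually_lt_const hη
  have hdensity (δ : ℝ) (hδ : 0 < δ) :
      ∀ᶠ n : ℕ in atTop, 1 - 4 * ε - δ < ((S ∩ Set.Icc 1 n).ncard : ℝ) / n :=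
    eventually_lt_ncard_div_of_lt_lowerDensity (by linarith)
  constructor
  · intro hI
    have hblocks := mul_ncard_blocks_le hmono₁ (by simp [ha₀]) hL (ν := lam - ε + c) hdisj
      fun i hi => by
        have h := (Real.le_log_iff_exp_le (div_pos (hapos _) (hapos _))).2 (hI i hi)
        rw [Real.log_div (hapos _).ne' (hapos _).ne'] at h
        push_cast
        linarith
    rw [← hS] at hblocks
    have hν : 0 < lam - ε + c := by linarith
    refine le_of_forall_pos_le_add fun η hη => ?_
    rw [← sub_le_iff_le_add]
    refine le_liminf_of_le (isBoundedUnder_of_eventually_le hupper).isCoboundedUnder_ge ?_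
    filter_upwards [hdensity (η / (2 * (lam - ε + c))) (by positivity),
      hboundary (L * |lam - ε + c|) (η / 2) (half_pos hη), eventually_gt_atTop 0] with n hd hb hn
    have hn' : (0 : ℝ) < n := mod_cast hn
    have h1 := div_le_div_of_nonneg_right (hblocks n) hn'.le
    rw [sub_div, add_div, mul_div_assoc, mul_div_cancel_right₀ _ hn'.ne'] at h1
    have h2 := mul_lt_mul_of_pos_left hd hν
    have h3 : (lam - ε + c) * (η / (2 * (lam - ε + c))) = η / 2 := by field_simp
    rw [mul_sub, h3] at h2
    linarith
  · intro hI
    have hblocks := mul_ncard_blocks_le hmono₂ (by simp [ha₀]) hL (ν := c - (lam + ε)) hdisj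
      fun i hi => by
        have h := (Real.log_le_iff_le_exp (div_pos (hapos _) (hapos _))).2 (hI i hi)
        rw [Real.log_div (hapos _).ne' (hapos _).ne'] at h
        push_cast
        linarith
    rw [← hS] at hblocks
    refine le_of_forall_pos_le_add fun η hη => ?_
    refine limsup_le_of_le (isBoundedUnder_of_eventually_ge hlower).isCoboundedUnder_le ?_
    filter_upwards [hdensity (η / (2 * (c + 1))) (by positivity),
      hboundary (L * |c - (lam + ε)|) (η / 2) (half_pos hη), eventually_gt_atTop 0] with n hd hb hn
    have hn' : (0 : ℝ) < n := mod_cast hn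
    have h1 := div_le_div_of_nonneg_right (hblocks n) hn'.le
    rw [sub_div, sub_div, mul_div_assoc, mul_div_cancel_right₀ _ hn'.ne'] at h1
    have h2 := mul_le_mul_of_nonneg_left hd.le hc₀
    have h3 : c * (η / (2 * (c + 1))) ≤ η / 2 := by
      rw [mul_div_assoc', div_le_div_iff₀ (by positivity) two_pos]
      nlinarith
    have h4 : ((S ∩ Set.Icc 1 n).ncard : ℝ) / n ≤ 1 :=
      (div_le_one hn').2 (mod_cast ncard_inter_Icc_le S n)
    have h5 := mul_le_mul_of_nonneg_left h4 (by linarith : 0 ≤ lam + ε)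
    linarith
end
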